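/- (Proposition: rbmo × h¹.) Let f ∈ rbmo(μ) and let h = Σ_j b_j with Σ_j |b_j| < ∞, where each b_j is supported in a cube R_j, b_j is an ∞-atomic block when ℓ(R_j) ≤ 1 and an ∞-block when ℓ(R_j) > 1. Then: (i) the series Σ_j (f − f_{R̃_j}) b_j converges absolutely in L¹(μ); and (ii) the partial sums k_N = Σ_{j=1}^N f_{R̃_j} b_j are Cauchy in h^℘_*(μ), i.e. Σ_{m∈ℤ^d} ‖M^{(1)}(k_N − k_M)‖_{L^℘(m+𝕢, μ)} → 0 as N, M → ∞. Consequently the product f × h splits as an L¹(μ) function plus an element of h^℘_*(μ). -/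

import Mathlib

open MeasureTheory Metric Set Filter
open scoped ENNReal NNReal BigOperators Topology

noncomputable section

/-- Euclidean space `ℝ^d`. -/
abbrev Euc (d : ℕ) := EuclideanSpace ℝ (Fin d)

/-- A (closed, axis-parallel) cube in `ℝ^d`, given by its center and side length. -/
structure Cube (d : ℕ) where
  center : Euc d
  side : ℝ

namespace Cube

/-- The underlying set of a cube. -/
def set {d : ℕ} (Q : Cube d) : Set (Euc d) :=
  {y : Euc d | ∀ i, |y i - Q.center i| ≤ Q.side / 2}

/-- The concentric dilate `αQ` of a cube. -/
def dilate {d : ℕ} (Q : Cube d) (α : ℝ) : Cube d := ⟨Q.center, α * Q.side⟩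

end Cube

/-- `Q` is a genuine cube for `μ`: positive side length, centered at a point of `supp μ`. -/
def IsCube {d : ℕ} (μ : Measure (Euc d)) (Q : Cube d) : Prop :=
  0 < Q.side ∧ ∀ r : ℝ, 0 < r → 0 < μ (Metric.ball Q.center r)

/-- The mean value `f_Q = μ(Q)⁻¹ ∫_Q f dμ`. -/
def cubeAvg {d : ℕ} (μ : Measure (Euc d)) (Q : Cube d) (f : Euc d → ℝ) : ℝ :=
  (μ Q.set).toReal⁻¹ * ∫ x in Q.set, f x ∂μ

/-- `N_{Q,R}`: the smallest positive integer `k` with `2^k ℓ(Q) ≥ ℓ(R)`. -/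
def NQR {d : ℕ} (Q R : Cube d) : ℕ :=
  sInf {k : ℕ | 0 < k ∧ R.side ≤ 2 ^ k * Q.side}

/-- The Tolsa coefficient `S_{Q,R} = 1 + ∑_{k=1}^{N_{Q,R}} μ(2^k Q)/ℓ(2^k Q)^n`. -/
def SQR {d : ℕ} (μ : Measure (Euc d)) (n : ℕ) (Q R : Cube d) : ℝ :=
  1 + ∑ k ∈ Finset.Icc 1 (NQR Q R),
      (μ (Q.dilate (2 ^ k)).set).toReal / (2 ^ k * Q.side) ^ n

/-- `Q` is `(α,β)`-doubling: `μ(αQ) ≤ β μ(Q)`. -/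
def IsDoubling {d : ℕ} (μ : Measure (Euc d)) (α β : ℝ) (Q : Cube d) : Prop :=
  μ (Q.dilate α).set ≤ ENNReal.ofReal β * μ Q.set

/-- `Q̃ = 2^N Q`, `N` the smallest non-negative integer making `2^N Q` `(ρ,β)`-doubling. -/
def tilde {d : ℕ} (μ : Measure (Euc d)) (ρ β : ℝ) (Q : Cube d) : Cube d :=
  Q.dilate (2 ^ sInf {N : ℕ | IsDoubling μ ρ β (Q.dilate (2 ^ N))})

/-- `C` is an `RBMO(μ)` bound for `f` (with parameters `η, ρ, β`). -/
def RBMOBound {d : ℕ} (μ : Measure (Euc d)) (n : ℕ) (η ρ β : ℝ)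
    (f : Euc d → ℝ) (C : ℝ) : Prop :=
  (∀ Q : Cube d, IsCube μ Q →
      ∫ x in Q.set, |f x - cubeAvg μ (tilde μ ρ β Q) f| ∂μ
        ≤ C * (μ (Q.dilate η).set).toReal) ∧
  (∀ Q R : Cube d, IsCube μ Q → IsCube μ R → Q.set ⊆ R.set →
      IsDoubling μ ρ β Q → IsDoubling μ ρ β R →
      |cubeAvg μ Q f - cubeAvg μ R f| ≤ C * SQR μ n Q R)

/-- `f ∈ RBMO(μ)`. -/
def MemRBMO {d : ℕ} (μ : Measure (Euc d)) (n : ℕ) (η ρ β : ℝ) (f : Euc d → ℝ) : Prop :=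
  LocallyIntegrable f μ ∧ ∃ C : ℝ, 0 ≤ C ∧ RBMOBound μ n η ρ β f C

/-- The `RBMO(μ)` norm of `f`. -/
def rbmoNorm {d : ℕ} (μ : Measure (Euc d)) (n : ℕ) (η ρ β : ℝ) (f : Euc d → ℝ) : ℝ :=
  sInf {C : ℝ | 0 ≤ C ∧ RBMOBound μ n η ρ β f C}

/-- `C` is an `rbmo(μ)` (local `RBMO`) bound for `f`. -/
def RbmoLocBound {d : ℕ} (μ : Measure (Euc d)) (n : ℕ) (η ρ β : ℝ)
    (f : Euc d → ℝ) (C : ℝ) : Prop :=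
  (∀ Q : Cube d, IsCube μ Q → Q.side ≤ 1 →
      ∫ x in Q.set, |f x - cubeAvg μ (tilde μ ρ β Q) f| ∂μ
        ≤ C * (μ (Q.dilate η).set).toReal) ∧
  (∀ Q R : Cube d, IsCube μ Q → IsCube μ R → Q.side ≤ 1 → Q.set ⊆ R.set →
      IsDoubling μ ρ β Q → IsDoubling μ ρ β R →
      |cubeAvg μ Q f - cubeAvg μ R f| ≤ C * SQR μ n Q R) ∧
  (∀ Q : Cube d, IsCube μ Q → 1 < Q.side →
      ∫ x in Q.set, |f x| ∂μ ≤ C * (μ (Q.dilate η).set).toReal)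

/-- `f ∈ rbmo(μ)`. -/
def MemRbmoLoc {d : ℕ} (μ : Measure (Euc d)) (n : ℕ) (η ρ β : ℝ) (f : Euc d → ℝ) : Prop :=
  LocallyIntegrable f μ ∧ ∃ C : ℝ, 0 ≤ C ∧ RbmoLocBound μ n η ρ β f C

/-- The `rbmo(μ)` norm of `f`. -/
def rbmoLocNorm {d : ℕ} (μ : Measure (Euc d)) (n : ℕ) (η ρ β : ℝ) (f : Euc d → ℝ) : ℝ :=
  sInf {C : ℝ | 0 ≤ C ∧ RbmoLocBound μ n η ρ β f C}

/-- The data of an `∞`-block: `b = ∑ λ_j a_j`, supported in `R`, with `a_j` supported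
in `Q_j ⊂ R` and `‖a_j‖_{L^∞(μ)} ≤ (μ(2Q_j) S_{Q_j,R})⁻¹`, `∑_j |λ_j| < ∞`. -/
structure PreBlock {d : ℕ} (μ : Measure (Euc d)) (n : ℕ) : Type where
  R : Cube d
  Qs : ℕ → Cube d
  lam : ℕ → ℝ
  a : ℕ → Euc d → ℝ
  isCubeR : IsCube μ R
  isCubeQs : ∀ j, IsCube μ (Qs j)
  subsetQR : ∀ j, (Qs j).set ⊆ R.set
  measA : ∀ j, Measurable (a j)
  suppA : ∀ j, Function.support (a j) ⊆ (Qs j).set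
  boundA : ∀ j x, |a j x| ≤ ((μ ((Qs j).dilate 2).set).toReal * SQR μ n (Qs j) R)⁻¹
  summable : Summable fun j => |lam j|

/-- The function determined by a block. -/
def PreBlock.fn {d : ℕ} {μ : Measure (Euc d)} {n : ℕ} (b : PreBlock μ n) : Euc d → ℝ :=
  fun x => ∑' j, b.lam j * b.a j x

/-- `|b| = ∑_j |λ_j|`. -/
def PreBlock.size {d : ℕ} {μ : Measure (Euc d)} {n : ℕ} (b : PreBlock μ n) : ℝ :=
  ∑' j, |b.lam j|

/-- An `∞`-atomic block: an `∞`-block with vanishing integral. -/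
structure AtomicBlock {d : ℕ} (μ : Measure (Euc d)) (n : ℕ) extends PreBlock μ n where
  cancel : ∫ x, (∑' j, lam j * a j x) ∂μ = 0

/-- The function determined by an atomic block. -/
def AtomicBlock.fn {d : ℕ} {μ : Measure (Euc d)} {n : ℕ} (b : AtomicBlock μ n) : Euc d → ℝ :=
  b.toPreBlock.fn

/-- `|b|_{H¹} = ∑_j |λ_j|`. -/
def AtomicBlock.size {d : ℕ} {μ : Measure (Euc d)} {n : ℕ} (b : AtomicBlock μ n) : ℝ :=
  b.toPreBlock.size

/-- The class of test functions `F(x)` of Tolsa's grand maximal function. -/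
def TestFun {d : ℕ} (μ : Measure (Euc d)) (n : ℕ) (x : Euc d) (φ : Euc d → ℝ) : Prop :=
  Integrable φ μ ∧ ContDiff ℝ 1 φ ∧ (∫ y, |φ y| ∂μ) ≤ 1 ∧
  (∀ y, 0 ≤ φ y) ∧ (∀ y, y ≠ x → φ y ≤ (‖y - x‖ ^ n)⁻¹) ∧
  (∀ y, y ≠ x → ‖fderiv ℝ φ y‖ ≤ (‖y - x‖ ^ (n + 1))⁻¹)

/-- The grand maximal function `M f(x) = sup_{φ ∈ F(x)} |∫ f φ dμ|`. -/
def grandM {d : ℕ} (μ : Measure (Euc d)) (n : ℕ) (f : Euc d → ℝ) (x : Euc d) : ℝ :=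
  sSup {r : ℝ | ∃ φ : Euc d → ℝ, TestFun μ n x φ ∧ r = |∫ y, f y * φ y ∂μ|}

/-- The local class `F_loc(x)`: test functions supported in the cube `Q(x,1)`. -/
def TestFunLoc {d : ℕ} (μ : Measure (Euc d)) (n : ℕ) (x : Euc d) (φ : Euc d → ℝ) : Prop :=
  TestFun μ n x φ ∧ Function.support φ ⊆ (Cube.mk x 1).set

/-- The local grand maximal function `M^{(1)} f(x) = sup_{φ ∈ F_loc(x)} |∫ f φ dμ|`. -/
def grandMLoc {d : ℕ} (μ : Measure (Euc d)) (n : ℕ) (f : Euc d → ℝ) (x : Euc d) : ℝ :=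
  sSup {r : ℝ | ∃ φ : Euc d → ℝ, TestFunLoc μ n x φ ∧ r = |∫ y, f y * φ y ∂μ|}

/-- The Orlicz quasi-norm of `u` on the set `E`, for the Orlicz function `P`
(with value `∞` when no admissible constant exists). -/
def orliczNormOn {α : Type*} [MeasurableSpace α] (P : ℝ → ℝ) (lam : Measure α)
    (E : Set α) (u : α → ℝ) : ℝ≥0∞ :=
  sInf {k : ℝ≥0∞ | 0 < k ∧ k ≠ ∞ ∧
    ∫⁻ x in E, ENNReal.ofReal (P (|u x| / k.toReal)) ∂lam ≤ 1}

/-- The Orlicz quasi-norm of `u`. -/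
def orliczNorm {α : Type*} [MeasurableSpace α] (P : ℝ → ℝ) (lam : Measure α)
    (u : α → ℝ) : ℝ≥0∞ :=
  orliczNormOn P lam Set.univ u

/-- `℘(t) = t / log(e+t)`. -/
def wp (t : ℝ) : ℝ := t / Real.log (Real.exp 1 + t)

/-- `℘̃(t) = t · log(e+t)`. -/
def wpDual (t : ℝ) : ℝ := t * Real.log (Real.exp 1 + t)

/-- `Ξ(t) = e^t − 1`. -/
def XiFun (t : ℝ) : ℝ := Real.exp t - 1

/-- `dν(x) = dμ(x)/log(e+|x|)`. -/
def nuMeas {d : ℕ} (μ : Measure (Euc d)) : Measure (Euc d) :=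
  μ.withDensity fun x => ENNReal.ofReal (Real.log (Real.exp 1 + ‖x‖))⁻¹

/-- `dσ(x) = dμ(x)/(1+|x|)^{2n+κ}`. -/
def sigmaMeas {d : ℕ} (μ : Measure (Euc d)) (n : ℕ) (κ : ℝ) : Measure (Euc d) :=
  μ.withDensity fun x => ENNReal.ofReal (((1 + ‖x‖) ^ (2 * (n : ℝ) + κ))⁻¹)

/-- The unit cube `m + [0,1)^d` of the lattice `ℤ^d`. -/
def latCube (d : ℕ) (m : Fin d → ℤ) : Set (Euc d) :=
  {x : Euc d | ∀ i, (m i : ℝ) ≤ x i ∧ x i < (m i : ℝ) + 1}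

/-! ### Cubes -/

namespace Cube

variable {d : ℕ}

theorem set_subset_set {x y : Euc d} {r s : ℝ} (h : ∀ i, |x i - y i| + r / 2 ≤ s / 2) :
    (Cube.mk x r).set ⊆ (Cube.mk y s).set := by
  intro z hz i
  have h1 := hz i
  have h2 := h i
  have h3 : |z i - y i| ≤ |z i - x i| + |x i - y i| := abs_sub_le _ _ _
  simp only at h1 ⊢
  linarith

theorem set_mono {x : Euc d} {r s : ℝ} (h : r ≤ s) :
    (Cube.mk x r).set ⊆ (Cube.mk x s).set :=
  set_subset_set fun i => by simpa using by linarith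

theorem center_mem {x : Euc d} {r : ℝ} (h : 0 ≤ r) : x ∈ (Cube.mk x r).set := by
  intro i
  simpa using by linarith

theorem ball_subset {x : Euc d} {r : ℝ} : Metric.ball x (r / 2) ⊆ (Cube.mk x r).set := by
  intro y hy i
  rw [Metric.mem_ball, dist_eq_norm] at hy
  exact ((PiLp.norm_apply_le (y - x) i).trans hy.le)

theorem isClosed_set (Q : Cube d) : IsClosed Q.set := by
  have : Q.set = ⋂ i, {y : Euc d | |y i - Q.center i| ≤ Q.side / 2} := by
    ext y; simp [Cube.set]
  rw [this]
  refine isClosed_iInter fun i => isClosed_le ?_ continuous_const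
  fun_prop

theorem measurableSet_set (Q : Cube d) : MeasurableSet Q.set := Q.isClosed_set.measurableSet

theorem norm_sub_le {x y : Euc d} {r : ℝ} (h : y ∈ (Cube.mk x r).set) :
    ‖y - x‖ ≤ d * (r / 2) := by
  have h1 : ‖y - x‖ ≤ ∑ i, ‖(y - x) i‖ := by
    have h2 : y - x = ∑ i, EuclideanSpace.single i ((y - x) i) := by
      ext j
      simp
    calc ‖y - x‖ = ‖∑ i, EuclideanSpace.single i ((y - x) i)‖ := by rw [← h2]
      _ ≤ _ := (norm_sum_le _ _).trans (by simp)
  refine h1.trans ((Finset.sum_le_card_nsmul _ _ (r / 2) fun i _ => h i).trans ?_)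
  simp

theorem isCompact_set (Q : Cube d) : IsCompact Q.set :=
  Metric.isCompact_of_isClosed_isBounded Q.isClosed_set
    ((Metric.isBounded_closedBall (x := Q.center) (r := d * (Q.side / 2))).subset fun y hy => by
      rw [mem_closedBall_iff_norm]
      exact norm_sub_le (x := Q.center) (r := Q.side) hy)

theorem convex_set (Q : Cube d) : Convex ℝ Q.set := by
  intro x hx y hy a b ha hb hab i
  have e : (a • x + b • y) i - Q.center i = a * (x i - Q.center i) + b * (y i - Q.center i) := by
    simp only [PiLp.add_apply, PiLp.smul_apply, smul_eq_mul]
    linear_combination (Q.center i) * hab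
  rw [e]
  calc _ ≤ |a * (x i - Q.center i)| + |b * (y i - Q.center i)| := abs_add_le _ _
    _ = a * |x i - Q.center i| + b * |y i - Q.center i| := by
        rw [abs_mul, abs_mul, abs_of_nonneg ha, abs_of_nonneg hb]
    _ ≤ a * (Q.side / 2) + b * (Q.side / 2) := by gcongr; exacts [hx i, hy i]
    _ = Q.side / 2 := by rw [← add_mul, hab, one_mul]

theorem side_le_of_subset (hd : 0 < d) {Q R : Cube d} (hQ : 0 ≤ Q.side) (h : Q.set ⊆ R.set) :
    Q.side ≤ R.side := by
  let i : Fin d := ⟨0, hd⟩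
  have hQ' : 0 ≤ Q.side / 2 := by linarith
  have hp : Q.center + EuclideanSpace.single i (Q.side / 2) ∈ Q.set := by
    intro j
    by_cases hj : j = i
    · subst hj; simp [abs_of_nonneg (hQ')]
    · simp [hj, hQ']
  have hm : Q.center - EuclideanSpace.single i (Q.side / 2) ∈ Q.set := by
    intro j
    by_cases hj : j = i
    · subst hj; simp [abs_of_nonneg (hQ')]
    · simp [hj, hQ']
  have h1 := abs_le.1 (h hp i)
  have h2 := abs_le.1 (h hm i)
  simp at h1 h2
  linarith [h1.1, h1.2, h2.1, h2.2]

/-- The least integer `k` with `ℓ ≤ 2 ^ k`. -/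
def scale (r : ℝ) : ℤ := Int.clog 2 r

theorem le_zpow_scale (r : ℝ) : r ≤ (2 : ℝ) ^ scale r := by
  unfold scale
  simpa using Int.self_le_zpow_clog (b := 2) (by norm_num) r

theorem zpow_scale_lt {r : ℝ} (hr : 0 < r) : (2 : ℝ) ^ scale r < 2 * r := by
  have := Int.zpow_pred_clog_lt_self (b := 2) (by norm_num) hr
  rw [zpow_sub_one₀ (by norm_num)] at this
  unfold scale
  push_cast at this
  linarith

theorem scale_zpow (k : ℤ) : scale ((2 : ℝ) ^ k) = k := by
  unfold scale
  simpa using Int.clog_zpow (R := ℝ) (b := 2) (by norm_num) k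

theorem scale_mono {r s : ℝ} (hr : 0 < r) (h : r ≤ s) : scale r ≤ scale s :=
  Int.clog_mono_right hr h

theorem lt_of_zpow_lt {k l : ℤ} (h : (2 : ℝ) ^ k < 2 ^ l) : k < l :=
  (zpow_lt_zpow_iff_right₀ (by norm_num)).1 h

theorem scale_le_iff {r : ℝ} (hr : 0 < r) {k : ℤ} : scale r ≤ k ↔ r ≤ 2 ^ k := by
  constructor
  · intro h
    exact (le_zpow_scale r).trans (zpow_le_zpow_right₀ (by norm_num) h)
  · intro h
    rw [← scale_zpow k]
    exact scale_mono hr h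

theorem scale_two_pow_mul {r : ℝ} (hr : 0 < r) (m : ℕ) : scale (2 ^ m * r) = scale r + m := by
  have h2 : (0 : ℝ) < 2 ^ m := by positivity
  apply le_antisymm
  · rw [scale_le_iff (by positivity), zpow_add₀ (by norm_num), zpow_natCast, mul_comm]
    gcongr
    exact le_zpow_scale r
  · rw [← le_sub_iff_add_le, scale_le_iff hr, zpow_sub₀ (by norm_num), zpow_natCast,
      le_div_iff₀ h2, mul_comm]
    exact le_zpow_scale _

end Cube

theorem zpow_two_succ (k : ℤ) : (2 : ℝ) ^ (k + 1) = 2 * 2 ^ k := by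
  rw [zpow_add_one₀ (by norm_num), mul_comm]

/-- The dyadic cube of side `2 ^ k` centered at `x`. -/
def cub {d : ℕ} (x : Euc d) (k : ℤ) : Set (Euc d) := (Cube.mk x ((2 : ℝ) ^ k)).set

theorem mem_cub {d : ℕ} {x y : Euc d} {k : ℤ} : y ∈ cub x k ↔ ∀ i, |y i - x i| ≤ 2 ^ k / 2 :=
  Iff.rfl

theorem mem_cub_comm {d : ℕ} {x y : Euc d} {k : ℤ} : y ∈ cub x k ↔ x ∈ cub y k := by
  simp only [mem_cub, abs_sub_comm]

theorem cub_mono {d : ℕ} {x : Euc d} {k l : ℤ} (h : k ≤ l) : cub x k ⊆ cub x l :=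
  Cube.set_mono (zpow_le_zpow_right₀ (by norm_num) h)

theorem self_mem_cub {d : ℕ} (x : Euc d) (k : ℤ) : x ∈ cub x k := Cube.center_mem (by positivity)

theorem cub_subset_cub_succ {d : ℕ} {x y : Euc d} {k : ℤ} (h : x ∈ cub y k) :
    cub x k ⊆ cub y (k + 1) := by
  refine Cube.set_subset_set fun i => ?_
  have := h i
  rw [zpow_two_succ]
  simp only at this
  linarith

theorem measurableSet_cub {d : ℕ} (x : Euc d) (k : ℤ) : MeasurableSet (cub x k) :=
  Cube.measurableSet_set _

theorem set_subset_cub {d : ℕ} (Q : Cube d) : Q.set ⊆ cub Q.center (Cube.scale Q.side) :=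
  Cube.set_mono (x := Q.center) (Cube.le_zpow_scale _)

/-- The centers that are admissible for cubes: the points of the support of `μ`. -/
def admissible {d : ℕ} (μ : Measure (Euc d)) : Set (Euc d) :=
  {x | ∀ r : ℝ, 0 < r → 0 < μ (Metric.ball x r)}

/-- The growth condition of order `n` with constant `C₀`, for balls and for cubes. -/
structure HasGrowth {d : ℕ} (μ : Measure (Euc d)) (n : ℕ) (C₀ : ℝ) : Prop where
  pos : 0 < C₀
  ball : ∀ x : Euc d, ∀ r : ℝ, 0 < r → μ (Metric.ball x r) ≤ ENNReal.ofReal (C₀ * r ^ n)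
  cube : ∀ Q : Cube d, IsCube μ Q → μ Q.set ≤ ENNReal.ofReal (C₀ * Q.side ^ n)

theorem measure_compl_admissible {d : ℕ} (μ : Measure (Euc d)) : μ (admissible μ)ᶜ = 0 := by
  refine measure_mono_null ?_ (Measure.measure_compl_support (μ := μ))
  rw [Set.compl_subset_compl]
  intro x hx r hr
  exact (Measure.mem_support_iff_forall x).1 hx _ (Metric.ball_mem_nhds x hr)

namespace HasGrowth

variable {d n : ℕ} {μ : Measure (Euc d)} {C₀ : ℝ}

theorem isLocallyFiniteMeasure (h : HasGrowth μ n C₀) : IsLocallyFiniteMeasure μ :=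
  ⟨fun x => ⟨Metric.ball x 1, Metric.ball_mem_nhds x one_pos,
    (h.ball x 1 one_pos).trans_lt ENNReal.ofReal_lt_top⟩⟩

theorem measure_set_ne_top (h : HasGrowth μ n C₀) (Q : Cube d) : μ Q.set ≠ ⊤ := by
  have := h.isLocallyFiniteMeasure
  exact Q.isCompact_set.measure_lt_top.ne

theorem measure_cub_ne_top (h : HasGrowth μ n C₀) (x : Euc d) (k : ℤ) : μ (cub x k) ≠ ⊤ :=
  h.measure_set_ne_top _

theorem real_set_le (h : HasGrowth μ n C₀) {x : Euc d} (hx : x ∈ admissible μ) {r : ℝ}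
    (hr : 0 < r) : μ.real (Cube.mk x r).set ≤ C₀ * r ^ n :=
  ENNReal.toReal_le_of_le_ofReal (by have := h.pos; positivity) (h.cube ⟨x, r⟩ ⟨hr, hx⟩)

theorem real_cub_le (h : HasGrowth μ n C₀) {x : Euc d} (hx : x ∈ admissible μ) (k : ℤ) :
    μ.real (cub x k) ≤ C₀ * ((2 : ℝ) ^ k) ^ n :=
  h.real_set_le hx (by positivity)

theorem real_set_mono (h : HasGrowth μ n C₀) {Q R : Cube d} (hQR : Q.set ⊆ R.set) :
    μ.real Q.set ≤ μ.real R.set :=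
  measureReal_mono hQR (h.measure_set_ne_top R)

theorem real_set_pos (h : HasGrowth μ n C₀) {x : Euc d} (hx : x ∈ admissible μ) {r : ℝ}
    (hr : 0 < r) : 0 < μ.real (Cube.mk x r).set :=
  ENNReal.toReal_pos ((hx (r / 2) (by linarith)).trans_le (measure_mono Cube.ball_subset)).ne'
    (h.measure_set_ne_top _)

end HasGrowth

/-! ### Dyadic densities -/

/-- The density `μ(Q) / ℓ(Q)ⁿ` of the dyadic cube `Q` of side `2 ^ k` centered at `x`. -/
def theta {d : ℕ} (μ : Measure (Euc d)) (n : ℕ) (x : Euc d) (k : ℤ) : ℝ :=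
  μ.real (cub x k) / ((2 : ℝ) ^ k) ^ n

/-- The sum of the densities of the dyadic cubes centered at `x` of scales in `[a, b)`. -/
def sig {d : ℕ} (μ : Measure (Euc d)) (n : ℕ) (x : Euc d) (a b : ℤ) : ℝ :=
  ∑ k ∈ Finset.Ico a b, theta μ n x k

section

variable {d n : ℕ} {μ : Measure (Euc d)} {C₀ : ℝ}

theorem theta_nonneg (x : Euc d) (k : ℤ) : 0 ≤ theta μ n x k := by unfold theta; positivity

theorem sig_nonneg (x : Euc d) (a b : ℤ) : 0 ≤ sig μ n x a b :=
  Finset.sum_nonneg fun _ _ => theta_nonneg _ _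

theorem theta_le (h : HasGrowth μ n C₀) {x : Euc d} (hx : x ∈ admissible μ) (k : ℤ) :
    theta μ n x k ≤ C₀ := by
  unfold theta
  rw [div_le_iff₀ (by positivity)]
  exact h.real_cub_le hx k

theorem sig_le_card (h : HasGrowth μ n C₀) {x : Euc d} (hx : x ∈ admissible μ) (a b : ℤ) :
    sig μ n x a b ≤ (b - a).toNat * C₀ := by
  refine (Finset.sum_le_card_nsmul _ _ C₀ fun k _ => theta_le h hx k).trans ?_
  simp

theorem sig_triangle (x : Euc d) (a b c : ℤ) :
    sig μ n x a c ≤ sig μ n x a b + sig μ n x b c := by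
  unfold sig
  refine (Finset.sum_le_sum_of_subset_of_nonneg (t := Finset.Ico a b ∪ Finset.Ico b c) ?_
    fun _ _ _ => theta_nonneg _ _).trans ?_
  · intro k hk
    simp only [Finset.mem_union, Finset.mem_Ico] at *
    omega
  · rw [← Finset.sum_union_inter]
    exact le_add_of_nonneg_right (Finset.sum_nonneg fun _ _ => theta_nonneg _ _)

theorem sig_mono (x : Euc d) {a a' b b' : ℤ} (ha : a' ≤ a) (hb : b ≤ b') :
    sig μ n x a b ≤ sig μ n x a' b' :=
  Finset.sum_le_sum_of_subset_of_nonneg (Finset.Ico_subset_Ico ha hb)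
    fun _ _ _ => theta_nonneg _ _

theorem theta_shift (h : HasGrowth μ n C₀) {x y : Euc d} {k : ℤ} (hxy : x ∈ cub y k) :
    theta μ n x k ≤ 2 ^ n * theta μ n y (k + 1) := by
  unfold theta
  rw [zpow_two_succ, mul_pow, ← mul_div_assoc, mul_div_mul_left _ _ (by positivity)]
  exact div_le_div_of_nonneg_right (h.real_set_mono (cub_subset_cub_succ hxy)) (by positivity)

theorem sum_theta_succ (x : Euc d) (a b : ℤ) :
    ∑ k ∈ Finset.Ico a b, theta μ n x (k + 1) = sig μ n x (a + 1) (b + 1) := by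
  unfold sig
  rw [← Finset.image_add_right_Ico, Finset.sum_image (by simp)]

theorem sig_succ_le (h : HasGrowth μ n C₀) {x : Euc d} (hx : x ∈ admissible μ) (a b : ℤ) (m : ℕ) :
    sig μ n x a (b + m) ≤ sig μ n x a b + m * C₀ := by
  refine (sig_triangle x a b (b + m)).trans ?_
  have := sig_le_card h hx b (b + m)
  simp only [add_sub_cancel_left, Int.toNat_natCast] at this
  linarith

theorem sig_shift (h : HasGrowth μ n C₀) {x y : Euc d} (hy : y ∈ admissible μ)
    {a b : ℤ} (hxy : x ∈ cub y a) :
    sig μ n x a b ≤ 2 ^ n * (sig μ n y a b + C₀) := by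
  calc sig μ n x a b ≤ ∑ k ∈ Finset.Ico a b, 2 ^ n * theta μ n y (k + 1) :=
        Finset.sum_le_sum fun k hk => theta_shift h (cub_mono (Finset.mem_Ico.1 hk).1 hxy)
    _ = 2 ^ n * sig μ n y (a + 1) (b + 1) := by rw [← Finset.mul_sum, sum_theta_succ]
    _ ≤ _ := by
        gcongr
        have := sig_succ_le h hy a b 1
        simp only [Nat.cast_one, one_mul] at this
        exact (sig_mono y (by omega) le_rfl).trans this

end

/-- The density `μ(Q) / ℓ(Q)ⁿ` of the cube `Q` of side `r` centered at `x`. -/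
def dens {d : ℕ} (μ : Measure (Euc d)) (n : ℕ) (x : Euc d) (r : ℝ) : ℝ :=
  μ.real (Cube.mk x r).set / r ^ n

section

variable {d n : ℕ} {μ : Measure (Euc d)} {C₀ : ℝ}

theorem dens_nonneg {x : Euc d} {r : ℝ} (hr : 0 < r) : 0 ≤ dens μ n x r := by
  unfold dens; positivity

theorem dens_le (h : HasGrowth μ n C₀) {x : Euc d} (hx : x ∈ admissible μ) {r : ℝ} (hr : 0 < r) :
    dens μ n x r ≤ C₀ := by
  unfold dens
  rw [div_le_iff₀ (by positivity)]
  exact h.real_set_le hx hr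

theorem dens_le_theta (h : HasGrowth μ n C₀) (x : Euc d) {r : ℝ} (hr : 0 < r) :
    dens μ n x r ≤ 2 ^ n * theta μ n x (Cube.scale r) := by
  unfold dens theta
  rw [← mul_div_assoc, div_le_div_iff₀ (by positivity) (by positivity)]
  calc μ.real (Cube.mk x r).set * (2 ^ Cube.scale r) ^ n
      ≤ μ.real (cub x (Cube.scale r)) * (2 * r) ^ n :=
        mul_le_mul (h.real_set_mono (set_subset_cub ⟨x, r⟩))
          (pow_le_pow_left₀ (by positivity) (Cube.zpow_scale_lt hr).le n) (by positivity)
          (by positivity)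
    _ = _ := by rw [mul_pow]; ring

theorem theta_pred_le_dens (h : HasGrowth μ n C₀) (x : Euc d) {r : ℝ} (hr : 0 < r) :
    theta μ n x (Cube.scale r - 1) ≤ 2 ^ n * dens μ n x r := by
  unfold dens theta
  have h2 : (2 : ℝ) ^ Cube.scale r = 2 * 2 ^ (Cube.scale r - 1) := by
    rw [← zpow_two_succ]; simp
  have h3 := Cube.zpow_scale_lt hr
  have h4 := Cube.le_zpow_scale r
  rw [← mul_div_assoc, div_le_div_iff₀ (by positivity) (by positivity)]
  calc μ.real (cub x (Cube.scale r - 1)) * r ^ n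
      ≤ μ.real (Cube.mk x r).set * (2 * 2 ^ (Cube.scale r - 1)) ^ n :=
        mul_le_mul (h.real_set_mono (Cube.set_mono (by linarith)))
          (pow_le_pow_left₀ hr.le (by linarith) n) (by positivity) (by positivity)
    _ = _ := by rw [mul_pow]; ring

theorem SQR_eq (Q R : Cube d) :
    SQR μ n Q R = 1 + ∑ k ∈ Finset.Icc 1 (NQR Q R), dens μ n Q.center (2 ^ k * Q.side) := rfl

theorem one_le_SQR {Q R : Cube d} (hQ : 0 < Q.side) : 1 ≤ SQR μ n Q R := by
  rw [SQR_eq]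
  exact le_add_of_nonneg_right (Finset.sum_nonneg fun k _ => dens_nonneg (by positivity))

theorem sum_Icc_theta (x : Euc d) (a : ℤ) (N : ℕ) :
    ∑ k ∈ Finset.Icc 1 N, theta μ n x (a + k) = sig μ n x (a + 1) (a + 1 + N) := by
  unfold sig
  refine Finset.sum_nbij' (fun k => a + k) (fun z => (z - a).toNat) ?_ ?_ ?_ ?_ ?_
  all_goals simp
  all_goals omega

theorem NQR_spec {Q R : Cube d} (hQ : 0 < Q.side) :
    0 < NQR Q R ∧ R.side ≤ 2 ^ NQR Q R * Q.side := by
  apply Nat.sInf_mem (s := {k : ℕ | 0 < k ∧ R.side ≤ 2 ^ k * Q.side})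
  obtain ⟨k, hk⟩ := pow_unbounded_of_one_lt (R.side / Q.side) (one_lt_two (α := ℝ))
  refine ⟨k + 1, by omega, ?_⟩
  rw [div_lt_iff₀ hQ] at hk
  have : (2 : ℝ) ^ k * Q.side ≤ 2 ^ (k + 1) * Q.side := by gcongr <;> norm_num
  linarith

theorem scale_add_NQR_le {Q R : Cube d} (hQ : 0 < Q.side) (hQR : Q.side ≤ R.side) :
    Cube.scale Q.side + NQR Q R ≤ Cube.scale R.side + 1 := by
  obtain ⟨hpos, -⟩ := NQR_spec (R := R) hQ
  obtain ⟨m, hm⟩ : ∃ m, NQR Q R = m + 1 := ⟨NQR Q R - 1, by omega⟩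
  have key : 2 ^ m * Q.side ≤ R.side := by
    rcases Nat.eq_zero_or_pos m with rfl | hm0
    · simpa
    · by_contra! hc
      have : NQR Q R ≤ m := Nat.sInf_le ⟨hm0, hc.le⟩
      omega
  have := Cube.scale_mono (by positivity) key
  rw [Cube.scale_two_pow_mul hQ] at this
  omega

theorem SQR_le (h : HasGrowth μ n C₀) {Q R : Cube d} (hQ : IsCube μ Q) (hQR : Q.side ≤ R.side) :
    SQR μ n Q R ≤
      1 + 2 ^ n * (sig μ n Q.center (Cube.scale Q.side) (Cube.scale R.side) + 2 * C₀) := by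
  rw [SQR_eq]
  gcongr 1 + ?_
  calc ∑ k ∈ Finset.Icc 1 (NQR Q R), dens μ n Q.center (2 ^ k * Q.side)
      ≤ ∑ k ∈ Finset.Icc 1 (NQR Q R), 2 ^ n * theta μ n Q.center (Cube.scale Q.side + k) := by
        refine Finset.sum_le_sum fun k _ => ?_
        have := hQ.1
        rw [← Cube.scale_two_pow_mul hQ.1]
        exact dens_le_theta h _ (by positivity)
    _ = 2 ^ n * sig μ n Q.center (Cube.scale Q.side + 1) (Cube.scale Q.side + 1 + NQR Q R) := by
        rw [← Finset.mul_sum, sum_Icc_theta]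
    _ ≤ _ := by
        gcongr
        have h1 := scale_add_NQR_le hQ.1 hQR
        refine (sig_mono _ (by omega) (by push_cast; omega)).trans (sig_succ_le h hQ.2 _ _ 2)

theorem sig_le_SQR (h : HasGrowth μ n C₀) {Q R : Cube d} (hQ : 0 < Q.side) (hR : 0 < R.side) :
    1 + sig μ n Q.center (Cube.scale Q.side) (Cube.scale R.side) ≤ 2 ^ n * SQR μ n Q R := by
  have h1 : Cube.scale R.side ≤ Cube.scale Q.side + NQR Q R := by
    rw [← Cube.scale_two_pow_mul hQ]
    exact Cube.scale_mono hR (NQR_spec hQ).2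
  have h2 : sig μ n Q.center (Cube.scale Q.side) (Cube.scale R.side) ≤
      2 ^ n * ∑ k ∈ Finset.Icc 1 (NQR Q R), dens μ n Q.center (2 ^ k * Q.side) := by
    calc sig μ n Q.center (Cube.scale Q.side) (Cube.scale R.side)
        ≤ sig μ n Q.center (Cube.scale Q.side - 1 + 1)
            (Cube.scale Q.side - 1 + 1 + NQR Q R) := sig_mono _ (by omega) (by omega)
      _ = ∑ k ∈ Finset.Icc 1 (NQR Q R), theta μ n Q.center (Cube.scale Q.side - 1 + k) :=
          (sum_Icc_theta _ _ _).symm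
      _ ≤ ∑ k ∈ Finset.Icc 1 (NQR Q R), 2 ^ n * dens μ n Q.center (2 ^ k * Q.side) := by
          refine Finset.sum_le_sum fun k _ => ?_
          have h3 : Cube.scale Q.side - 1 + k = Cube.scale (2 ^ k * Q.side) - 1 := by
            rw [Cube.scale_two_pow_mul hQ]; ring
          rw [h3]
          exact theta_pred_le_dens h _ (by positivity)
      _ = _ := by rw [← Finset.mul_sum]
  have h3 : (1 : ℝ) ≤ 2 ^ n := one_le_pow₀ (by norm_num)
  rw [SQR_eq, mul_add]
  linarith

end

/-! ### Chains of non-doubling cubes -/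

theorem sum_range_le_of_chain {g : ℕ → ℝ} {C q : ℝ} {p m : ℕ} (hg : ∀ i, 0 ≤ g i)
    (hgC : ∀ i, g i ≤ C) (hq0 : 0 ≤ q) (hq : q < 1) (hchain : ∀ i < m, g i ≤ q * g (i + p)) :
    ∑ i ∈ Finset.range m, g i ≤ q * (p * C) / (1 - q) := by
  rw [le_div_iff₀ (by linarith)]
  have h1 : ∑ i ∈ Finset.range m, g i ≤ q * ∑ i ∈ Finset.range m, g (i + p) := by
    rw [Finset.mul_sum]
    exact Finset.sum_le_sum fun i hi => hchain i (Finset.mem_range.1 hi)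
  have h2 : ∑ i ∈ Finset.range m, g (i + p) ≤ ∑ i ∈ Finset.range m, g i + p * C := by
    have e1 : ∑ i ∈ Finset.range (p + m), g i =
        ∑ i ∈ Finset.range p, g i + ∑ i ∈ Finset.range m, g (i + p) := by
      rw [Finset.sum_range_add]; simp [add_comm]
    have e2 : ∑ i ∈ Finset.range (m + p), g i =
        ∑ i ∈ Finset.range m, g i + ∑ i ∈ Finset.range p, g (m + i) := Finset.sum_range_add _ _ _
    rw [add_comm p m] at e1
    have e3 : ∑ i ∈ Finset.range p, g (m + i) ≤ p * C := by
      refine (Finset.sum_le_card_nsmul _ _ C fun i _ => hgC _).trans ?_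
      simp
    have e4 : 0 ≤ ∑ i ∈ Finset.range p, g i := Finset.sum_nonneg fun i _ => hg i
    linarith
  have h3 := mul_le_mul_of_nonneg_left h2 hq0
  nlinarith

theorem exists_not_chain {g : ℕ → ℝ} {C q : ℝ} {p : ℕ} (hg : 0 < g 0)
    (hgC : ∀ i, g i ≤ C) (hq0 : 0 ≤ q) (hq : q < 1) : ∃ i, q * g (i + p) < g i := by
  by_contra! hc
  have h1 : ∀ j, g 0 ≤ q ^ j * g (j * p) := by
    intro j
    induction j with
    | zero => simp
    | succ j ih =>
      refine ih.trans ?_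
      rw [pow_succ, mul_assoc, add_mul, one_mul]
      exact mul_le_mul_of_nonneg_left (hc _) (by positivity)
  have hC : 0 < C := hg.trans_le (hgC 0)
  obtain ⟨j, hj⟩ := exists_pow_lt_of_lt_one (div_pos hg hC) hq
  rw [lt_div_iff₀ hC] at hj
  have := mul_le_mul_of_nonneg_left (hgC (j * p)) (pow_nonneg hq0 j)
  linarith [h1 j]

section

variable {d n : ℕ} {μ : Measure (Euc d)} {C₀ β : ℝ}

theorem isDoubling_iff (h : HasGrowth μ n C₀) (hβ : 0 ≤ β) (x : Euc d) (r : ℝ) :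
    IsDoubling μ 2 β ⟨x, r⟩ ↔
      μ.real (Cube.mk x (2 * r)).set ≤ β * μ.real (Cube.mk x r).set := by
  unfold IsDoubling
  change μ (Cube.mk x (2 * r)).set ≤ _ ↔ _
  rw [← ENNReal.toReal_le_toReal (h.measure_set_ne_top _)
    (ENNReal.mul_ne_top ENNReal.ofReal_ne_top (h.measure_set_ne_top _)), ENNReal.toReal_mul,
    ENNReal.toReal_ofReal hβ]
  rfl

theorem dens_le_of_not_isDoubling (h : HasGrowth μ n C₀) (hβ : 0 < β) {x : Euc d} {r : ℝ}
    (hr : 0 < r) (hd : ¬ IsDoubling μ 2 β ⟨x, r⟩) :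
    dens μ n x r ≤ 2 ^ n / β * dens μ n x (2 * r) := by
  rw [isDoubling_iff h hβ.le, not_le] at hd
  unfold dens
  have e : 2 ^ n / β * (μ.real (Cube.mk x (2 * r)).set / (2 * r) ^ n) =
      μ.real (Cube.mk x (2 * r)).set / (β * r ^ n) := by
    rw [mul_pow]; field_simp
  rw [e, div_le_div_iff₀ (by positivity) (by positivity)]
  have : 0 < r ^ n := by positivity
  nlinarith

theorem tilde_spec (h : HasGrowth μ n C₀) (hβ : (2 : ℝ) ^ n < β) {x : Euc d}
    (hx : x ∈ admissible μ) {r : ℝ} (hr : 0 < r) :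
    ∃ m : ℕ, tilde μ 2 β ⟨x, r⟩ = ⟨x, 2 ^ m * r⟩ ∧ IsDoubling μ 2 β ⟨x, 2 ^ m * r⟩ ∧
      ∀ i < m, ¬ IsDoubling μ 2 β ⟨x, 2 ^ i * r⟩ := by
  have hβ0 : 0 < β := lt_trans (by positivity) hβ
  refine ⟨sInf {N : ℕ | IsDoubling μ 2 β ⟨x, 2 ^ N * r⟩}, rfl, ?_, fun i hi => ?_⟩
  · apply Nat.sInf_mem (s := {N : ℕ | IsDoubling μ 2 β ⟨x, 2 ^ N * r⟩})
    by_contra! hc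
    have hc' : ∀ i, ¬ IsDoubling μ 2 β ⟨x, 2 ^ i * r⟩ := fun i hi =>
      (Set.eq_empty_iff_forall_notMem.1 hc i) hi
    obtain ⟨i, hi⟩ := exists_not_chain (g := fun i => dens μ n x (2 ^ i * r)) (C := C₀)
      (q := 2 ^ n / β) (p := 1)
      (by
        have := h.real_set_pos hx hr
        simp only [pow_zero, one_mul, dens]
        positivity)
      (fun i => dens_le h hx (by positivity)) (by positivity) ((div_lt_one hβ0).2 hβ)
    have := dens_le_of_not_isDoubling h hβ0 (by positivity) (hc' i)
    rw [← mul_assoc, ← pow_succ'] at this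
    exact absurd this (not_le.2 hi)
  · exact fun hd => absurd (Nat.sInf_le (s := {N : ℕ | IsDoubling μ 2 β ⟨x, 2 ^ N * r⟩}) hd)
      (not_le.2 hi)

theorem sig_eq_sum_range (x : Euc d) (a : ℤ) (m : ℕ) :
    sig μ n x a (a + m) = ∑ i ∈ Finset.range m, theta μ n x (a + i) := by
  unfold sig
  refine (Finset.sum_nbij' (fun k : ℕ => a + k) (fun z => (z - a).toNat) ?_ ?_ ?_ ?_ ?_).symm
  all_goals simp
  all_goals omega

theorem sig_le_of_not_isDoubling (h : HasGrowth μ n C₀) (hβ : (2 : ℝ) ^ n < β) {x : Euc d}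
    (hx : x ∈ admissible μ) {r : ℝ} (hr : 0 < r) {m : ℕ}
    (hm : ∀ i < m, ¬ IsDoubling μ 2 β ⟨x, 2 ^ i * r⟩) :
    sig μ n x (Cube.scale r) (Cube.scale (2 ^ m * r)) ≤
      2 ^ n * (2 ^ n / β * C₀ / (1 - 2 ^ n / β) + C₀) := by
  have hβ0 : 0 < β := lt_trans (by positivity) hβ
  have h1 := sum_range_le_of_chain (g := fun i => dens μ n x (2 ^ i * r)) (C := C₀)
    (q := 2 ^ n / β) (p := 1) (m := m) (fun i => dens_nonneg (by positivity))
    (fun i => dens_le h hx (by positivity)) (by positivity) ((div_lt_one hβ0).2 hβ)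
    (fun i hi => by
      have := dens_le_of_not_isDoubling h hβ0 (by positivity) (hm i hi)
      rwa [← mul_assoc, ← pow_succ'] at this)
  rw [Nat.cast_one, one_mul] at h1
  rw [Cube.scale_two_pow_mul hr]
  rw [sig_eq_sum_range]
  calc ∑ i ∈ Finset.range m, theta μ n x (Cube.scale r + i)
      ≤ ∑ i ∈ Finset.range m, 2 ^ n * dens μ n x (2 ^ (i + 1) * r) := by
        refine Finset.sum_le_sum fun i _ => ?_
        have h3 : Cube.scale r + i = Cube.scale (2 ^ (i + 1) * r) - 1 := by
          rw [Cube.scale_two_pow_mul hr]; push_cast; ring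
        rw [h3]
        exact theta_pred_le_dens h _ (by positivity)
    _ = 2 ^ n * ∑ i ∈ Finset.range m, dens μ n x (2 ^ (i + 1) * r) := by rw [← Finset.mul_sum]
    _ ≤ _ := by
        gcongr
        have h4 := Finset.sum_range_succ' (fun i : ℕ => dens μ n x (2 ^ i * r)) m
        have h5 := Finset.sum_range_succ (fun i : ℕ => dens μ n x (2 ^ i * r)) m
        have h6 : 0 ≤ dens μ n x (2 ^ 0 * r) := dens_nonneg (by positivity)
        have h7 : dens μ n x (2 ^ m * r) ≤ C₀ := dens_le h hx (by positivity)
        linarith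

end

/-! ### Averages of local `rbmo` functions -/

/-- `c x r` are numbers attached to the cubes of side `r` centered at `x ∈ supp μ` that approximate
`f` in the sense of `rbmo(μ)`. -/
structure RbmoCoeffs {d : ℕ} (μ : Measure (Euc d)) (n : ℕ) (f : Euc d → ℝ) (c : Euc d → ℝ → ℝ)
    (K : ℝ) : Prop where
  nonneg : 0 ≤ K
  osc : ∀ x ∈ admissible μ, ∀ r : ℝ, 0 < r →
    ∫⁻ y in (Cube.mk x r).set, ENNReal.ofReal |f y - c x r| ∂μ ≤
      ENNReal.ofReal K * μ (Cube.mk x (2 * r)).set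
  diff : ∀ x ∈ admissible μ, ∀ y ∈ admissible μ, ∀ r s : ℝ, 0 < r → 0 < s →
    Cube.scale r ≤ Cube.scale s → x ∈ cub y (Cube.scale s) →
      |c x r - c y s| ≤ K * (1 + sig μ n x (Cube.scale r) (Cube.scale s))
  large : ∀ x ∈ admissible μ, ∀ r : ℝ, 1 < r → |c x r| ≤ K

section

variable {d n : ℕ} {μ : Measure (Euc d)} {C₀ β η C : ℝ} {f : Euc d → ℝ}

theorem abs_cubeAvg_le_of_one_lt (h : HasGrowth μ n C₀) (hβ : 0 ≤ β) (hη : η ≤ 2)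
    (hC : 0 ≤ C) (hf : RbmoLocBound μ n η 2 β f C) {x : Euc d} (hx : x ∈ admissible μ) {r : ℝ}
    (hr : 1 < r) (hd : IsDoubling μ 2 β ⟨x, r⟩) : |cubeAvg μ ⟨x, r⟩ f| ≤ C * β := by
  have hr0 : 0 < r := by linarith
  have h1 : ∫ y in (Cube.mk x r).set, |f y| ∂μ ≤ C * μ.real (Cube.mk x (η * r)).set :=
    hf.2.2 ⟨x, r⟩ ⟨hr0, hx⟩ hr
  have h2 : μ.real (Cube.mk x (η * r)).set ≤ μ.real (Cube.mk x (2 * r)).set :=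
    h.real_set_mono (Cube.set_mono (by gcongr))
  have h3 := (isDoubling_iff h hβ x r).1 hd
  have h4 := h.real_set_pos hx hr0
  unfold cubeAvg
  change |(μ.real (Cube.mk x r).set)⁻¹ * _| ≤ _
  rw [abs_mul, abs_of_pos (inv_pos.2 h4), inv_mul_le_iff₀ h4]
  refine (abs_integral_le_integral_abs).trans (h1.trans ?_)
  calc C * μ.real (Cube.mk x (η * r)).set ≤ C * (β * μ.real (Cube.mk x r).set) := by
        gcongr; exact h2.trans h3
    _ = _ := by ring

theorem abs_cubeAvg_sub_le (h : HasGrowth μ n C₀) (hβ : 0 ≤ β) (hη : η ≤ 2)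
    (hC : 0 ≤ C) (hf : RbmoLocBound μ n η 2 β f C) {x y : Euc d} (hx : x ∈ admissible μ)
    (hy : y ∈ admissible μ) {r s : ℝ} (hr : 0 < r) (hrs : r ≤ s)
    (hsub : (Cube.mk x r).set ⊆ (Cube.mk y s).set)
    (hd : IsDoubling μ 2 β ⟨x, r⟩) (hd' : IsDoubling μ 2 β ⟨y, s⟩) :
    |cubeAvg μ ⟨x, r⟩ f - cubeAvg μ ⟨y, s⟩ f| ≤
      2 * C * β + C * SQR μ n ⟨x, r⟩ ⟨y, s⟩ := by
  have h1 : 1 ≤ SQR μ n (Cube.mk x r) ⟨y, s⟩ := one_le_SQR hr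
  rcases le_or_gt r 1 with hr1 | hr1
  · have := hf.2.1 ⟨x, r⟩ ⟨y, s⟩ ⟨hr, hx⟩ ⟨hr.trans_le hrs, hy⟩ hr1 hsub hd hd'
    have : 0 ≤ 2 * C * β := by positivity
    linarith
  · have h2 := abs_cubeAvg_le_of_one_lt h hβ hη hC hf hx hr1 hd
    have h3 := abs_cubeAvg_le_of_one_lt h hβ hη hC hf hy (hr1.trans_le hrs) hd'
    have h4 := abs_sub (cubeAvg μ ⟨x, r⟩ f) (cubeAvg μ ⟨y, s⟩ f)
    have : 0 ≤ C * SQR μ n (Cube.mk x r) ⟨y, s⟩ := by positivity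
    linarith

theorem exists_abs_cubeAvg_tilde_sub_le (h : HasGrowth μ n C₀) (hβ : (2 : ℝ) ^ n < β) (hη : η ≤ 2)
    (hC : 0 ≤ C) (hf : RbmoLocBound μ n η 2 β f C) :
    ∃ K : ℝ, 0 ≤ K ∧ ∀ x ∈ admissible μ, ∀ y ∈ admissible μ, ∀ r s : ℝ, 0 < r → 0 < s →
      Cube.scale r ≤ Cube.scale s → x ∈ cub y (Cube.scale s) →
      |cubeAvg μ (tilde μ 2 β ⟨x, r⟩) f - cubeAvg μ (tilde μ 2 β ⟨y, s⟩) f| ≤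
        K * (1 + sig μ n x (Cube.scale r) (Cube.scale s)) := by
  have hβ0 : 0 < β := lt_trans (by positivity) hβ
  have hq : 2 ^ n / β < 1 := (div_lt_one hβ0).2 hβ
  have hC₀ := h.pos
  obtain ⟨K, hK⟩ : ∃ K, K = 2 ^ n * (2 ^ n / β * C₀ / (1 - 2 ^ n / β) + C₀) := ⟨_, rfl⟩
  have hK0 : 0 ≤ K := by
    rw [hK]
    have : 0 < 1 - 2 ^ n / β := by linarith
    positivity
  obtain ⟨T, hT⟩ : ∃ T, T = 2 ^ n * (K + C₀) := ⟨_, rfl⟩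
  have hT0 : 0 ≤ T := by rw [hT]; positivity
  refine ⟨4 * C * β + 2 * C * (1 + 2 ^ n * (1 + K + 3 * T + 3 * C₀)), by positivity, ?_⟩
  intro x hx y hy r s hr hs hrs hxy
  have hyx : y ∈ cub x (Cube.scale s) := mem_cub_comm.1 hxy
  obtain ⟨m, hmeq, hmd, hmn⟩ := tilde_spec h hβ hx hr
  obtain ⟨l, hleq, hld, hln⟩ := tilde_spec h hβ hy hs
  obtain ⟨a, ha⟩ : ∃ a, a = Cube.scale (2 ^ m * r) := ⟨_, rfl⟩
  obtain ⟨b, hb⟩ : ∃ b, b = Cube.scale (2 ^ l * s) := ⟨_, rfl⟩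
  obtain ⟨M, hM⟩ : ∃ M, M = max a b := ⟨_, rfl⟩
  have hp2 : (0 : ℝ) < 2 ^ (M + 1) := by positivity
  obtain ⟨p, hpeq, hpd, hpn⟩ := tilde_spec h hβ hy hp2
  obtain ⟨e, he⟩ : ∃ e, e = Cube.scale (2 ^ p * 2 ^ (M + 1)) := ⟨_, rfl⟩
  have h1 := sig_le_of_not_isDoubling h hβ hx hr hmn
  have h2 := sig_le_of_not_isDoubling h hβ hy hs hln
  have h3 := sig_le_of_not_isDoubling h hβ hy hp2 hpn
  rw [← hK, Cube.scale_zpow, ← he] at h3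
  rw [← hK, ← ha] at h1
  rw [← hK, ← hb] at h2
  rw [hmeq, hleq]
  have hra : Cube.scale r ≤ a := by rw [ha, Cube.scale_two_pow_mul hr]; omega
  have hsb : Cube.scale s ≤ b := by rw [hb, Cube.scale_two_pow_mul hs]; omega
  have haM : a ≤ M := by omega
  have hbM : b ≤ M := by omega
  have hMe : M + 1 ≤ e := by rw [he, Cube.scale_two_pow_mul hp2, Cube.scale_zpow]; omega
  -- densities at the scales between `s` and `2 ^ M`
  have hx1 : sig μ n x (Cube.scale s) a ≤ K := (sig_mono x hrs le_rfl).trans h1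
  have hx2 : sig μ n x (Cube.scale s) b ≤ T := (sig_shift h hy hxy).trans (by rw [hT]; gcongr)
  have hy1 : sig μ n y (Cube.scale s) a ≤ T :=
    (sig_shift h hx hyx).trans (by rw [hT]; gcongr)
  have hx3 : sig μ n x (Cube.scale s) M ≤ K + T := by
    rcases max_choice a b with hm | hm <;> rw [hM, hm]
    · linarith
    · linarith
  have hy3 : sig μ n y (Cube.scale s) M ≤ K + T := by
    rcases max_choice a b with hm | hm <;> rw [hM, hm]
    · linarith
    · linarith
  have hx4 : sig μ n x (M + 1) e ≤ T :=
    (sig_shift h hy (cub_mono (by omega) hxy)).trans (by rw [hT]; gcongr)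
  have hx5 := sig_le_card h hx M (M + 1)
  have hy5 := sig_le_card h hy M (M + 1)
  simp only [add_sub_cancel_left, Int.toNat_one, Nat.cast_one, one_mul] at hx5 hy5
  have hxe : sig μ n x a e ≤ sig μ n x (Cube.scale r) (Cube.scale s) + K + 2 * T + C₀ := by
    have t1 := sig_triangle (μ := μ) (n := n) x (Cube.scale r) (Cube.scale s) e
    have t2 := sig_triangle (μ := μ) (n := n) x (Cube.scale s) M e
    have t3 := sig_triangle (μ := μ) (n := n) x M (M + 1) e
    have t4 := sig_mono (μ := μ) (n := n) x hra (le_refl e)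
    linarith
  have hTK : K ≤ T := by
    rw [hT]
    have : (1 : ℝ) ≤ 2 ^ n := one_le_pow₀ (by norm_num)
    nlinarith
  have hye : sig μ n y b e ≤ K + 2 * T + C₀ := by
    have t2 := sig_triangle (μ := μ) (n := n) y (Cube.scale s) M e
    have t3 := sig_triangle (μ := μ) (n := n) y M (M + 1) e
    have t4 := sig_mono (μ := μ) (n := n) y hsb (le_refl e)
    linarith
  have hs0 := sig_nonneg (μ := μ) (n := n) x (Cube.scale r) (Cube.scale s)
  obtain ⟨σ, hσ⟩ : ∃ σ, σ = sig μ n x (Cube.scale r) (Cube.scale s) := ⟨_, rfl⟩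
  rw [← hσ] at hs0 hxe ⊢
  -- comparison with a large doubling cube centered at `y`
  have hsize : ∀ t : ℝ, Cube.scale t ≤ M → t ≤ 2 ^ M := fun t ht =>
    (Cube.le_zpow_scale t).trans (zpow_le_zpow_right₀ (by norm_num) ht)
  have hPge : (2 : ℝ) ^ (M + 1) ≤ 2 ^ p * 2 ^ (M + 1) :=
    le_mul_of_one_le_left hp2.le (one_le_pow₀ (by norm_num))
  have hz := zpow_two_succ M
  have hzM : (0 : ℝ) < 2 ^ M := by positivity
  have hsz1 := hsize _ (ha ▸ haM)
  have hsz2 := hsize _ (hb ▸ hbM)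
  have hsub1 : (Cube.mk x (2 ^ m * r)).set ⊆ (Cube.mk y (2 ^ p * 2 ^ (M + 1))).set := by
    refine Cube.set_subset_set fun i => ?_
    have := cub_mono (show Cube.scale s ≤ M by omega) hxy i
    simp only at this
    linarith
  have hsub2 : (Cube.mk y (2 ^ l * s)).set ⊆ (Cube.mk y (2 ^ p * 2 ^ (M + 1))).set :=
    Cube.set_mono (by linarith)
  have d1 := abs_cubeAvg_sub_le h hβ0.le hη hC hf hx hy (by positivity) (by linarith) hsub1 hmd hpd
  have d2 := abs_cubeAvg_sub_le h hβ0.le hη hC hf hy hy (by positivity) (by linarith) hsub2 hld hpd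
  have s1 := SQR_le h (Q := ⟨x, 2 ^ m * r⟩) (R := ⟨y, 2 ^ p * 2 ^ (M + 1)⟩)
    ⟨by simp only; positivity, hx⟩ (by simp only; linarith)
  have s2 := SQR_le h (Q := ⟨y, 2 ^ l * s⟩) (R := ⟨y, 2 ^ p * 2 ^ (M + 1)⟩)
    ⟨by simp only; positivity, hy⟩ (by simp only; linarith)
  simp only [← ha, ← hb, ← he] at s1 s2
  have s1' : SQR μ n ⟨x, 2 ^ m * r⟩ ⟨y, 2 ^ p * 2 ^ (M + 1)⟩ ≤
      (1 + 2 ^ n * (1 + K + 3 * T + 3 * C₀)) * (1 + σ) := by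
    refine s1.trans ?_
    have hA : (1 : ℝ) ≤ 1 + K + 3 * T + 3 * C₀ := by linarith
    have hp : (0 : ℝ) < 2 ^ n := by positivity
    generalize (2 : ℝ) ^ n = P at hp ⊢
    have g1 : P * (sig μ n x a e + 2 * C₀) ≤ P * ((1 + K + 3 * T + 3 * C₀) + σ) :=
      mul_le_mul_of_nonneg_left (by linarith) hp.le
    have g2 : P * σ * 1 ≤ P * σ * (1 + K + 3 * T + 3 * C₀) :=
      mul_le_mul_of_nonneg_left hA (by positivity)
    linarith
  have s2' : SQR μ n ⟨y, 2 ^ l * s⟩ ⟨y, 2 ^ p * 2 ^ (M + 1)⟩ ≤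
      (1 + 2 ^ n * (1 + K + 3 * T + 3 * C₀)) * (1 + σ) := by
    refine s2.trans ?_
    have hp : (0 : ℝ) < 2 ^ n := by positivity
    generalize (2 : ℝ) ^ n = P at hp ⊢
    have g1 : P * (sig μ n y b e + 2 * C₀) ≤ P * (1 + K + 3 * T + 3 * C₀) :=
      mul_le_mul_of_nonneg_left (by linarith) hp.le
    have g2 : 0 ≤ P * (1 + K + 3 * T + 3 * C₀) * σ := by positivity
    linarith
  have tri := abs_sub_le (cubeAvg μ ⟨x, 2 ^ m * r⟩ f) (cubeAvg μ ⟨y, 2 ^ p * 2 ^ (M + 1)⟩ f)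
    (cubeAvg μ ⟨y, 2 ^ l * s⟩ f)
  rw [abs_sub_comm] at d2
  have e1 := mul_le_mul_of_nonneg_left s1' hC
  have e2 := mul_le_mul_of_nonneg_left s2' hC
  have e3 : 0 ≤ 4 * C * β * σ := by positivity
  calc _ ≤ 4 * C * β
        + 2 * (C * ((1 + 2 ^ n * (1 + K + 3 * T + 3 * C₀)) * (1 + σ))) := by linarith
    _ ≤ _ := by linarith

theorem exists_rbmoCoeffs (h : HasGrowth μ n C₀) (hβ : (2 : ℝ) ^ n < β) (hη : η ≤ 2)
    (hf : MemRbmoLoc μ n η 2 β f) :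
    ∃ K, RbmoCoeffs μ n f (fun x r => cubeAvg μ (tilde μ 2 β ⟨x, r⟩) f) K := by
  obtain ⟨hloc, C, hC, hb⟩ := hf
  have hβ0 : 0 < β := lt_trans (by positivity) hβ
  have := h.isLocallyFiniteMeasure
  obtain ⟨K, hK0, hK⟩ := exists_abs_cubeAvg_tilde_sub_le h hβ hη hC hb
  have hlarge : ∀ x ∈ admissible μ, ∀ r : ℝ, 1 < r →
      |cubeAvg μ (tilde μ 2 β ⟨x, r⟩) f| ≤ C * β := by
    intro x hx r hr
    obtain ⟨m, hmeq, hmd, -⟩ := tilde_spec h hβ hx (by linarith)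
    rw [hmeq]
    have : (1 : ℝ) ≤ 2 ^ m := one_le_pow₀ (by norm_num)
    exact abs_cubeAvg_le_of_one_lt h hβ0.le hη hC hb hx (by nlinarith) hmd
  refine ⟨K + C + C * β, by positivity, ?_, ?_, ?_⟩
  · intro x hx r hr
    have hint : IntegrableOn f (Cube.mk x r).set μ :=
      hloc.integrableOn_isCompact (Cube.isCompact_set _)
    have hfin := h.measure_set_ne_top (Cube.mk x r)
    have hη2 : μ.real (Cube.mk x (η * r)).set ≤ μ.real (Cube.mk x (2 * r)).set :=
      h.real_set_mono (Cube.set_mono (by gcongr))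
    have h12 : μ.real (Cube.mk x r).set ≤ μ.real (Cube.mk x (2 * r)).set :=
      h.real_set_mono (Cube.set_mono (by linarith))
    have hint' : IntegrableOn
        (fun y => f y - cubeAvg μ (tilde μ 2 β ⟨x, r⟩) f) (Cube.mk x r).set μ :=
      hint.sub (integrableOn_const (hs := hfin))
    have key : ∫ y in (Cube.mk x r).set, |f y - cubeAvg μ (tilde μ 2 β ⟨x, r⟩) f| ∂μ ≤
        (K + C + C * β) * μ.real (Cube.mk x (2 * r)).set := by
      rcases le_or_gt r 1 with hr1 | hr1
      · calc _ ≤ C * μ.real (Cube.mk x (η * r)).set := hb.1 ⟨x, r⟩ ⟨hr, hx⟩ hr1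
          _ ≤ (K + C + C * β) * μ.real (Cube.mk x (2 * r)).set := by
            gcongr
            have : 0 ≤ C * β := by positivity
            linarith
      · calc _ ≤ ∫ y in (Cube.mk x r).set, (|f y| + C * β) ∂μ := by
              refine setIntegral_mono hint'.abs
                (hint.abs.add (integrableOn_const (hs := hfin))) fun y => ?_
              exact (abs_sub _ _).trans (by gcongr; exact hlarge x hx r hr1)
          _ = ∫ y in (Cube.mk x r).set, |f y| ∂μ + C * β * μ.real (Cube.mk x r).set := by
              rw [integral_add hint.abs (integrableOn_const (hs := hfin)), setIntegral_const,
                smul_eq_mul, mul_comm (μ.real _)]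
          _ ≤ C * μ.real (Cube.mk x (η * r)).set + C * β * μ.real (Cube.mk x r).set := by
              gcongr
              exact hb.2.2 ⟨x, r⟩ ⟨hr, hx⟩ hr1
          _ ≤ C * μ.real (Cube.mk x (2 * r)).set + C * β * μ.real (Cube.mk x (2 * r)).set := by
              gcongr
          _ ≤ _ := by
              have : 0 ≤ K * μ.real (Cube.mk x (2 * r)).set := by positivity
              linarith
    rw [← ofReal_integral_eq_lintegral_ofReal hint'.abs (ae_of_all _ fun y => abs_nonneg _),
      ← ENNReal.ofReal_toReal (h.measure_set_ne_top (Cube.mk x (2 * r))),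
      ← ENNReal.ofReal_mul (by positivity)]
    exact ENNReal.ofReal_le_ofReal key
  · intro x hx y hy r s hr hs hrs hxy
    refine (hK x hx y hy r s hr hs hrs hxy).trans ?_
    have := sig_nonneg (μ := μ) (n := n) x (Cube.scale r) (Cube.scale s)
    have h1 : 0 ≤ C * β := by positivity
    gcongr
    linarith
  · intro x hx r hr
    refine (hlarge x hx r hr).trans ?_
    linarith

end

/-! ### Blocks -/

theorem ofReal_abs_tsum_le (u : ℕ → ℝ) :
    ENNReal.ofReal |∑' i, u i| ≤ ∑' i, ENNReal.ofReal |u i| := by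
  simpa only [Real.enorm_eq_ofReal_abs] using enorm_tsum_le_tsum_enorm (f := u)

theorem RbmoCoeffs.abs_sub_le_SQR {d n : ℕ} {μ : Measure (Euc d)} {C₀ K : ℝ} {f : Euc d → ℝ}
    {c : Euc d → ℝ → ℝ} (hc : RbmoCoeffs μ n f c K) (h : HasGrowth μ n C₀) (hd : 0 < d)
    {Q R : Cube d} (hQ : IsCube μ Q) (hR : IsCube μ R) (hQR : Q.set ⊆ R.set) :
    |c Q.center Q.side - c R.center R.side| ≤ K * (2 ^ n * SQR μ n Q R) := by
  refine (hc.diff _ hQ.2 _ hR.2 _ _ hQ.1 hR.1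
    (Cube.scale_mono hQ.1 (Cube.side_le_of_subset hd hQ.1.le hQR))
    (set_subset_cub R (hQR (Cube.center_mem hQ.1.le)))).trans ?_
  exact mul_le_mul_of_nonneg_left (sig_le_SQR h hQ.1 hR.1) hc.nonneg

namespace PreBlock

variable {d n : ℕ} {μ : Measure (Euc d)} {C₀ K : ℝ} {f : Euc d → ℝ} {c : Euc d → ℝ → ℝ}

/-- The bound for `‖a_i‖_∞` in a block. -/
def height (b : PreBlock μ n) (i : ℕ) : ℝ :=
  (μ.real (Cube.mk (b.Qs i).center (2 * (b.Qs i).side)).set * SQR μ n (b.Qs i) b.R)⁻¹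

theorem abs_a_le (b : PreBlock μ n) (i : ℕ) (x : Euc d) : |b.a i x| ≤ b.height i := b.boundA i x

theorem height_nonneg (b : PreBlock μ n) (i : ℕ) : 0 ≤ b.height i :=
  (abs_nonneg _).trans (b.abs_a_le i 0)

theorem height_mul_eq_one (h : HasGrowth μ n C₀) (b : PreBlock μ n) (i : ℕ) :
    b.height i * (μ.real (Cube.mk (b.Qs i).center (2 * (b.Qs i).side)).set *
      SQR μ n (b.Qs i) b.R) = 1 := by
  have h1 := h.real_set_pos (b.isCubeQs i).2 (r := 2 * (b.Qs i).side)
    (by have := (b.isCubeQs i).1; linarith)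
  have h2 := one_le_SQR (μ := μ) (n := n) (R := b.R) (b.isCubeQs i).1
  exact inv_mul_cancel₀ (by positivity)

theorem height_mul_le_one (h : HasGrowth μ n C₀) (b : PreBlock μ n) (i : ℕ) :
    b.height i * μ.real (Cube.mk (b.Qs i).center (2 * (b.Qs i).side)).set ≤ 1 := by
  have h2 := one_le_SQR (μ := μ) (n := n) (R := b.R) (b.isCubeQs i).1
  calc _ ≤ b.height i * (μ.real (Cube.mk (b.Qs i).center (2 * (b.Qs i).side)).set *
      SQR μ n (b.Qs i) b.R) := by
        gcongr
        · exact b.height_nonneg i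
        · exact le_mul_of_one_le_right measureReal_nonneg h2
    _ = 1 := b.height_mul_eq_one h i

theorem real_le_real_double (h : HasGrowth μ n C₀) (b : PreBlock μ n) (i : ℕ) :
    μ.real (b.Qs i).set ≤ μ.real (Cube.mk (b.Qs i).center (2 * (b.Qs i).side)).set :=
  h.real_set_mono (Cube.set_mono (x := (b.Qs i).center)
    (by have := (b.isCubeQs i).1; linarith))

theorem height_mul_mul_SQR_le (h : HasGrowth μ n C₀) (b : PreBlock μ n) (i : ℕ) :
    b.height i * μ.real (b.Qs i).set * SQR μ n (b.Qs i) b.R ≤ 1 := by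
  have h2 := one_le_SQR (μ := μ) (n := n) (R := b.R) (b.isCubeQs i).1
  rw [← b.height_mul_eq_one h i, mul_assoc]
  exact mul_le_mul_of_nonneg_left (mul_le_mul_of_nonneg_right (b.real_le_real_double h i)
    (by linarith)) (b.height_nonneg i)

theorem tsum_ofReal_lam (b : PreBlock μ n) :
    ∑' i, ENNReal.ofReal |b.lam i| = ENNReal.ofReal b.size :=
  (ENNReal.ofReal_tsum_of_nonneg (fun _ => abs_nonneg _) b.summable).symm

theorem size_nonneg (b : PreBlock μ n) : 0 ≤ b.size := tsum_nonneg fun _ => abs_nonneg _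

theorem lintegral_osc_a_le (hc : RbmoCoeffs μ n f c K) (h : HasGrowth μ n C₀) (hd : 0 < d)
    (b : PreBlock μ n) (i : ℕ) :
    ∫⁻ x, ENNReal.ofReal (|f x - c b.R.center b.R.side| * |b.a i x|) ∂μ ≤
      ENNReal.ofReal (K + K * 2 ^ n) := by
  set Q := b.Qs i
  set cR := c b.R.center b.R.side
  set cQ := c Q.center Q.side
  have hK := hc.nonneg
  have hS := one_le_SQR (μ := μ) (n := n) (R := b.R) (b.isCubeQs i).1
  have hα := b.height_nonneg i
  set M := μ.real (Cube.mk Q.center (2 * Q.side)).set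
  have hM : μ (Cube.mk Q.center (2 * Q.side)).set = ENNReal.ofReal M :=
    (ofReal_measureReal (h.measure_set_ne_top _)).symm
  have hdiff := hc.abs_sub_le_SQR h hd (b.isCubeQs i) b.isCubeR (b.subsetQR i)
  have hosc : ∫⁻ x in Q.set, ENNReal.ofReal |f x - cR| ∂μ ≤
      ENNReal.ofReal (K * M + K * (2 ^ n * SQR μ n Q b.R) * M) := by
    calc ∫⁻ x in Q.set, ENNReal.ofReal |f x - cR| ∂μ
        ≤ ∫⁻ x in Q.set, (ENNReal.ofReal |f x - cQ| +
            ENNReal.ofReal (K * (2 ^ n * SQR μ n Q b.R))) ∂μ := by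
          refine lintegral_mono fun x => ?_
          rw [← ENNReal.ofReal_add (abs_nonneg _) (by positivity)]
          refine ENNReal.ofReal_le_ofReal ((abs_sub_le _ cQ _).trans ?_)
          gcongr
      _ = ∫⁻ x in Q.set, ENNReal.ofReal |f x - cQ| ∂μ +
            ENNReal.ofReal (K * (2 ^ n * SQR μ n Q b.R)) * μ Q.set := by
          rw [lintegral_add_right _ measurable_const, setLIntegral_const]
      _ ≤ ENNReal.ofReal K * ENNReal.ofReal M +
            ENNReal.ofReal (K * (2 ^ n * SQR μ n Q b.R)) * ENNReal.ofReal M := by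
          rw [← hM]
          gcongr
          · exact hc.osc _ (b.isCubeQs i).2 _ (b.isCubeQs i).1
          · exact Cube.set_mono (x := Q.center) (by have := (b.isCubeQs i).1; linarith)
      _ = _ := by
          rw [← ENNReal.ofReal_mul hK, ← ENNReal.ofReal_mul (by positivity),
            ← ENNReal.ofReal_add (by positivity) (by positivity)]
  calc ∫⁻ x, ENNReal.ofReal (|f x - cR| * |b.a i x|) ∂μ
      = ∫⁻ x in Q.set, ENNReal.ofReal (|f x - cR| * |b.a i x|) ∂μ := by
        refine (setLIntegral_eq_of_support_subset ?_).symm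
        intro x hx
        refine b.suppA i ?_
        contrapose! hx
        simp only [Function.mem_support, not_not] at hx
        simp [hx]
    _ ≤ ∫⁻ x in Q.set, ENNReal.ofReal (b.height i) * ENNReal.ofReal |f x - cR| ∂μ := by
        refine lintegral_mono fun x => ?_
        rw [← ENNReal.ofReal_mul hα, mul_comm]
        refine ENNReal.ofReal_le_ofReal ?_
        gcongr
        exact b.abs_a_le i x
    _ = ENNReal.ofReal (b.height i) * ∫⁻ x in Q.set, ENNReal.ofReal |f x - cR| ∂μ :=
        lintegral_const_mul' _ _ ENNReal.ofReal_ne_top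
    _ ≤ ENNReal.ofReal (b.height i) *
          ENNReal.ofReal (K * M + K * (2 ^ n * SQR μ n Q b.R) * M) := by gcongr
    _ ≤ _ := by
        rw [← ENNReal.ofReal_mul hα]
        refine ENNReal.ofReal_le_ofReal ?_
        have h1 : b.height i * (M * SQR μ n Q b.R) = 1 := b.height_mul_eq_one h i
        have h2 : b.height i * M ≤ 1 := b.height_mul_le_one h i
        calc _ = K * (b.height i * M) + K * 2 ^ n * (b.height i * (M * SQR μ n Q b.R)) := by ring
          _ ≤ K * 1 + K * 2 ^ n * 1 := by rw [h1]; gcongr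
          _ = _ := by ring

theorem lintegral_osc_le (hc : RbmoCoeffs μ n f c K) (h : HasGrowth μ n C₀) (hd : 0 < d)
    (hf : AEMeasurable f μ) (b : PreBlock μ n) :
    ∫⁻ x, ENNReal.ofReal (|f x - c b.R.center b.R.side| * |b.fn x|) ∂μ ≤
      ENNReal.ofReal (K + K * 2 ^ n) * ENNReal.ofReal b.size := by
  set cR := c b.R.center b.R.side
  calc ∫⁻ x, ENNReal.ofReal (|f x - cR| * |b.fn x|) ∂μ
      ≤ ∫⁻ x, ∑' i, ENNReal.ofReal |b.lam i| * ENNReal.ofReal (|f x - cR| * |b.a i x|) ∂μ := by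
        refine lintegral_mono fun x => ?_
        rw [ENNReal.ofReal_mul (abs_nonneg _)]
        refine (mul_le_mul_right (ofReal_abs_tsum_le _) _).trans ?_
        rw [← ENNReal.tsum_mul_left]
        refine ENNReal.tsum_le_tsum fun i => le_of_eq ?_
        rw [abs_mul, ENNReal.ofReal_mul (abs_nonneg _), ENNReal.ofReal_mul (abs_nonneg _)]
        ring
    _ = ∑' i, ENNReal.ofReal |b.lam i| *
          ∫⁻ x, ENNReal.ofReal (|f x - cR| * |b.a i x|) ∂μ := by
        rw [lintegral_tsum]
        · exact tsum_congr fun i => lintegral_const_mul' _ _ ENNReal.ofReal_ne_top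
        · intro i
          have := (b.measA i).aemeasurable (μ := μ)
          have h2 : AEMeasurable (fun x => |f x - cR|) μ := (hf.sub_const _).abs
          have h3 : AEMeasurable (fun x => |b.a i x|) μ := this.abs
          exact (h2.mul h3).ennreal_ofReal.const_mul _
    _ ≤ ∑' i, ENNReal.ofReal |b.lam i| * ENNReal.ofReal (K + K * 2 ^ n) :=
        ENNReal.tsum_le_tsum fun i => by gcongr; exact b.lintegral_osc_a_le hc h hd i
    _ = _ := by rw [ENNReal.tsum_mul_right, b.tsum_ofReal_lam, mul_comm]

theorem tsum_lintegral_osc_lt_top (hc : RbmoCoeffs μ n f c K) (h : HasGrowth μ n C₀) (hd : 0 < d)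
    (hf : AEMeasurable f μ) (B : ℕ → PreBlock μ n) (hB : Summable fun j => (B j).size) :
    ∑' j, ∫⁻ x, ENNReal.ofReal
      (|f x - c (B j).R.center (B j).R.side| * |(B j).fn x|) ∂μ < ⊤ := by
  refine (ENNReal.tsum_le_tsum fun j => (B j).lintegral_osc_le hc h hd hf).trans_lt ?_
  rw [ENNReal.tsum_mul_left, ← ENNReal.ofReal_tsum_of_nonneg (fun j => (B j).size_nonneg) hB]
  exact ENNReal.mul_lt_top ENNReal.ofReal_lt_top ENNReal.ofReal_lt_top

end PreBlock

/-! ### A John–Nirenberg inequality for dyadic coefficients -/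

/-- Numbers `a x k` attached to the dyadic cubes centered at the support of `μ` that approximate
`f` in the sense of `rbmo(μ)`. -/
structure DyadicCoeffs {d : ℕ} (μ : Measure (Euc d)) (n : ℕ) (f : Euc d → ℝ) (a : Euc d → ℤ → ℝ)
    (K : ℝ) : Prop where
  nonneg : 0 ≤ K
  osc : ∀ x ∈ admissible μ, ∀ k : ℤ,
    ∫⁻ y in cub x k, ENNReal.ofReal |f y - a x k| ∂μ ≤ ENNReal.ofReal K * μ (cub x (k + 1))
  diff : ∀ x ∈ admissible μ, ∀ y ∈ admissible μ, ∀ k l : ℤ, k ≤ l → x ∈ cub y l →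
    |a x k - a y l| ≤ K * (1 + sig μ n x k l)
  large : ∀ x ∈ admissible μ, ∀ k : ℤ, 1 ≤ k → |a x k| ≤ K

theorem RbmoCoeffs.dyadicCoeffs {d n : ℕ} {μ : Measure (Euc d)} {K : ℝ} {f : Euc d → ℝ}
    {c : Euc d → ℝ → ℝ} (hc : RbmoCoeffs μ n f c K) :
    DyadicCoeffs μ n f (fun x k => c x ((2 : ℝ) ^ k)) K where
  nonneg := hc.nonneg
  osc x hx k := by
    have := hc.osc x hx ((2 : ℝ) ^ k) (by positivity)
    rwa [← zpow_two_succ] at this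
  diff x hx y hy k l hkl hxy := by
    have := hc.diff x hx y hy ((2 : ℝ) ^ k) ((2 : ℝ) ^ l) (by positivity) (by positivity)
    simp only [Cube.scale_zpow] at this
    exact this hkl hxy
  large x hx k hk := hc.large x hx _ (one_lt_zpow₀ (by norm_num) (by omega))

section

variable {d n : ℕ} {μ : Measure (Euc d)} {C₀ K : ℝ} {f : Euc d → ℝ} {a : Euc d → ℤ → ℝ}

/-- Above every scale there is one at which the measure does not grow too fast, and the sum of the
densities up to that scale is controlled. -/
theorem exists_real_cub_le (h : HasGrowth μ n C₀) {x : Euc d} (hx : x ∈ admissible μ) (k : ℤ) :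
    ∃ l : ℤ, k ≤ l ∧ μ.real (cub x (l + 3)) ≤ 2 * 8 ^ n * μ.real (cub x l) ∧
      sig μ n x k l ≤ 3 * C₀ := by
  classical
  have hex := exists_not_chain (g := fun i : ℕ => theta μ n x (k + i)) (C := C₀) (q := 1 / 2)
    (p := 3) (by
      have := h.real_set_pos hx (r := (2 : ℝ) ^ (k + (0 : ℕ))) (by positivity)
      unfold theta cub
      positivity)
    (fun i => theta_le h hx _) (by norm_num) (by norm_num)
  have hm := Nat.find_spec hex
  have hmin := fun i (hi : i < Nat.find hex) => not_lt.1 (Nat.find_min hex hi)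
  set m := Nat.find hex
  refine ⟨k + m, by omega, ?_, ?_⟩
  · have e : (2 : ℝ) ^ (k + ((m + 3 : ℕ) : ℤ)) = 8 * 2 ^ (k + (m : ℤ)) := by
      push_cast
      rw [← add_assoc, zpow_add₀ (by norm_num) _ 3]
      norm_num
      ring
    have e3 : k + ((m + 3 : ℕ) : ℤ) = k + m + 3 := by push_cast; ring
    simp only [theta, e, mul_pow] at hm
    rw [e3] at hm
    have h2 : (0 : ℝ) < (2 ^ (k + (m : ℤ))) ^ n := by positivity
    have h8 : (0 : ℝ) < 8 ^ n := by positivity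
    have e2 : 1 / 2 * (μ.real (cub x (k + m + 3)) / (8 ^ n * (2 ^ (k + (m : ℤ))) ^ n)) =
      (1 / (2 * 8 ^ n) * μ.real (cub x (k + m + 3))) / (2 ^ (k + (m : ℤ))) ^ n := by
      field_simp
    rw [e2, div_lt_div_iff_of_pos_right h2, div_mul_eq_mul_div, one_mul,
      div_lt_iff₀ (by positivity)] at hm
    linarith
  · have := sum_range_le_of_chain (g := fun i : ℕ => theta μ n x (k + i)) (C := C₀) (q := 1 / 2)
      (p := 3) (m := m) (fun i => theta_nonneg _ _) (fun i => theta_le h hx _) (by norm_num)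
      (by norm_num) hmin
    rw [sig_eq_sum_range]
    refine this.trans (le_of_eq ?_)
    push_cast
    ring

/-- The points of `cub x₀ k₀` at which some coefficient of scale at most `k₀` differs by more than
`t` from the coefficient of `cub x₀ k₀`. -/
def deviationSet {d : ℕ} (μ : Measure (Euc d)) (a : Euc d → ℤ → ℝ) (x₀ : Euc d) (k₀ : ℤ) (t : ℝ) :
    Set (Euc d) :=
  {x | x ∈ admissible μ ∧ x ∈ cub x₀ k₀ ∧ ∃ k ≤ k₀, t < |a x k - a x₀ k₀|}

theorem exists_stopping_scale (ha : DyadicCoeffs μ n f a K) (h : HasGrowth μ n C₀) {x₀ x : Euc d}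
    (hx₀ : x₀ ∈ admissible μ) {k₀ : ℤ} {s : ℝ} (hs : K * (1 + 3 * C₀) ≤ s)
    (hx : x ∈ deviationSet μ a x₀ k₀ s) :
    ∃ l < k₀, μ.real (cub x (l + 3)) ≤ 2 * 8 ^ n * μ.real (cub x l) ∧
      s - K * (1 + 3 * C₀) ≤ |a x l - a x₀ k₀| ∧ ∀ k, l < k → k ≤ k₀ → |a x k - a x₀ k₀| ≤ s := by
  obtain ⟨hxa, hxc, k₁, hk₁, hk₁s⟩ := hx
  obtain ⟨k, ⟨hk, hks⟩, hmax⟩ := Int.exists_greatest_of_bdd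
    (P := fun k => k ≤ k₀ ∧ s < |a x k - a x₀ k₀|) ⟨k₀, fun z hz => hz.1⟩ ⟨k₁, hk₁, hk₁s⟩
  obtain ⟨l, hkl, hl, hsig⟩ := exists_real_cub_le h hxa k
  have hlk : l < k₀ := by
    by_contra! hc
    have h1 := ha.diff x hxa x₀ hx₀ k k₀ hk hxc
    have h2 : sig μ n x k k₀ ≤ 3 * C₀ := (sig_mono x le_rfl hc).trans hsig
    have h3 : K * (1 + sig μ n x k k₀) ≤ K * (1 + 3 * C₀) :=
      mul_le_mul_of_nonneg_left (by linarith) ha.nonneg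
    linarith
  refine ⟨l, hlk, hl, ?_, fun j hj hjk => ?_⟩
  · have h1 := ha.diff x hxa x hxa k l hkl (self_mem_cub _ _)
    have h3 : K * (1 + sig μ n x k l) ≤ K * (1 + 3 * C₀) :=
      mul_le_mul_of_nonneg_left (by linarith) ha.nonneg
    have h4 := abs_sub_le (a x k) (a x l) (a x₀ k₀)
    linarith
  · by_contra! hc
    have := hmax j ⟨hjk, hc⟩
    omega

theorem lintegral_abs_sub_le (ha : DyadicCoeffs μ n f a K) (h : HasGrowth μ n C₀) {x₀ : Euc d}
    (hx₀ : x₀ ∈ admissible μ) (k₀ : ℤ) :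
    ∫⁻ y in cub x₀ (k₀ + 1), ENNReal.ofReal |f y - a x₀ k₀| ∂μ ≤
      ENNReal.ofReal (K * (2 + C₀)) * μ (cub x₀ (k₀ + 2)) := by
  have hK := ha.nonneg
  have hC := h.pos
  have h1 : |a x₀ (k₀ + 1) - a x₀ k₀| ≤ K * (1 + C₀) := by
    rw [abs_sub_comm]
    refine (ha.diff x₀ hx₀ x₀ hx₀ k₀ (k₀ + 1) (by omega) (self_mem_cub _ _)).trans ?_
    gcongr
    simpa using sig_le_card h hx₀ k₀ (k₀ + 1)
  calc ∫⁻ y in cub x₀ (k₀ + 1), ENNReal.ofReal |f y - a x₀ k₀| ∂μ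
      ≤ ∫⁻ y in cub x₀ (k₀ + 1), (ENNReal.ofReal |f y - a x₀ (k₀ + 1)| +
          ENNReal.ofReal (K * (1 + C₀))) ∂μ := by
        refine lintegral_mono fun y => ?_
        rw [← ENNReal.ofReal_add (abs_nonneg _) (by positivity)]
        refine ENNReal.ofReal_le_ofReal ((abs_sub_le _ (a x₀ (k₀ + 1)) _).trans ?_)
        gcongr
    _ = ∫⁻ y in cub x₀ (k₀ + 1), ENNReal.ofReal |f y - a x₀ (k₀ + 1)| ∂μ +
          ENNReal.ofReal (K * (1 + C₀)) * μ (cub x₀ (k₀ + 1)) := by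
        rw [lintegral_add_right _ measurable_const, setLIntegral_const]
    _ ≤ ENNReal.ofReal K * μ (cub x₀ (k₀ + 2)) +
          ENNReal.ofReal (K * (1 + C₀)) * μ (cub x₀ (k₀ + 2)) := by
        gcongr
        · have := ha.osc x₀ hx₀ (k₀ + 1)
          rwa [add_assoc] at this
        · exact cub_mono (by omega)
    _ = _ := by
        rw [← add_mul, ← ENNReal.ofReal_add hK (by positivity)]
        ring_nf

theorem ofReal_mul_measure_cub_le (ha : DyadicCoeffs μ n f a K) (h : HasGrowth μ n C₀)
    (hf : AEMeasurable f μ) {z : Euc d} (hz : z ∈ admissible μ) {l : ℤ} {r L D : ℝ} (hL : 0 ≤ L) (hD : 0 ≤ D)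
    (hgrow : μ.real (cub z (l + 1)) ≤ D * μ.real (cub z l)) (hr : L + K * D ≤ |a z l - r|) :
    ENNReal.ofReal L * μ (cub z l) ≤ ∫⁻ y in cub z l, ENNReal.ofReal |f y - r| ∂μ := by
  have hK := ha.nonneg
  have hfin := h.measure_cub_ne_top z l
  have hgrow' : μ (cub z (l + 1)) ≤ ENNReal.ofReal D * μ (cub z l) := by
    rw [← ofReal_measureReal hfin, ← ofReal_measureReal (h.measure_cub_ne_top z (l + 1)),
      ← ENNReal.ofReal_mul hD]
    exact ENNReal.ofReal_le_ofReal hgrow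
  have key : ENNReal.ofReal L * μ (cub z l) + ENNReal.ofReal (K * D) * μ (cub z l) ≤
      ∫⁻ y in cub z l, ENNReal.ofReal |f y - r| ∂μ + ENNReal.ofReal (K * D) * μ (cub z l) := by
    calc ENNReal.ofReal L * μ (cub z l) + ENNReal.ofReal (K * D) * μ (cub z l)
        = ∫⁻ y in cub z l, ENNReal.ofReal (L + K * D) ∂μ := by
          rw [setLIntegral_const, ENNReal.ofReal_add hL (by positivity), add_mul]
      _ ≤ ∫⁻ y in cub z l, (ENNReal.ofReal |f y - r| + ENNReal.ofReal |f y - a z l|) ∂μ := by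
          refine lintegral_mono fun y => ?_
          rw [← ENNReal.ofReal_add (abs_nonneg _) (abs_nonneg _)]
          refine ENNReal.ofReal_le_ofReal (hr.trans ((abs_sub_le _ (f y) _).trans ?_))
          rw [abs_sub_comm (a z l), add_comm]
      _ ≤ ∫⁻ y in cub z l, ENNReal.ofReal |f y - r| ∂μ +
            ∫⁻ y in cub z l, ENNReal.ofReal |f y - a z l| ∂μ :=
          (lintegral_add_left' (AEMeasurable.ennreal_ofReal (AEMeasurable.abs
            (hf.restrict.sub_const r))) _).le
      _ ≤ _ := by
          gcongr
          refine (ha.osc z hz l).trans ?_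
          rw [ENNReal.ofReal_mul hK, mul_assoc]
          gcongr
  exact ENNReal.le_of_add_le_add_right (ENNReal.mul_ne_top ENNReal.ofReal_ne_top hfin) key

theorem measure_deviationSet_succ_le (ha : DyadicCoeffs μ n f a K) (h : HasGrowth μ n C₀)
    (hf : AEMeasurable f μ) {L s t : ℝ} {q : ℝ≥0∞} (hL : 0 ≤ L)
    (hs : s = L + K * (2 * 8 ^ n) + K * (1 + 3 * C₀)) (ht : 0 ≤ t)
    (ih : ∀ x₀ ∈ admissible μ, ∀ k₀, μ (deviationSet μ a x₀ k₀ t) ≤ q * μ (cub x₀ (k₀ + 2)))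
    {x₀ : Euc d} (hx₀ : x₀ ∈ admissible μ) (k₀ : ℤ) :
    ENNReal.ofReal L * μ (deviationSet μ a x₀ k₀ (t + s)) ≤
      q * ENNReal.ofReal (2 * 8 ^ n) * (ENNReal.ofReal (K * (2 + C₀)) * μ (cub x₀ (k₀ + 2))) := by
  have hK := ha.nonneg
  have hC := h.pos
  set D := deviationSet μ a x₀ k₀ (t + s)
  have hsK : K * (1 + 3 * C₀) ≤ s := by
    have : 0 ≤ K * (2 * 8 ^ n) := by positivity
    linarith
  have hgood : ∀ x ∈ D, ∃ l < k₀, μ.real (cub x (l + 3)) ≤ 2 * 8 ^ n * μ.real (cub x l) ∧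
      s - K * (1 + 3 * C₀) ≤ |a x l - a x₀ k₀| ∧
        ∀ k, l < k → k ≤ k₀ → |a x k - a x₀ k₀| ≤ s := fun x hx =>
    exists_stopping_scale ha h hx₀ hsK ⟨hx.1, hx.2.1, by
      obtain ⟨k, hk, hkt⟩ := hx.2.2
      exact ⟨k, hk, by linarith⟩⟩
  choose! l hlk hgrow hdev hup using hgood
  obtain ⟨u, huD, hdisj, hcov⟩ := Vitali.exists_disjoint_subfamily_covering_enlargement
    (fun x => cub x (l x)) D (fun x => (2 : ℝ) ^ l x) (3 / 2) (by norm_num)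
    (fun x _ => by positivity) ((2 : ℝ) ^ k₀)
    (fun x hx => zpow_le_zpow_right₀ (by norm_num) (hlk x hx).le)
    (fun x _ => ⟨x, self_mem_cub _ _⟩)
  have hcount : u.Countable := hdisj.countable_of_nonempty_interior fun x _ =>
    ⟨x, mem_interior.2 ⟨_, Cube.ball_subset, isOpen_ball, mem_ball_self (by positivity)⟩⟩
  have hDcov : D ⊆ ⋃ z ∈ u, deviationSet μ a z (l z + 1) t := by
    intro x hx
    obtain ⟨z, hz, ⟨w, hwx, hwz⟩, hle⟩ := hcov x hx
    have hll : l x ≤ l z := by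
      have h1 : (2 : ℝ) ^ l x < 2 ^ (l z + 1) := by
        rw [zpow_two_succ]
        have : (0 : ℝ) < 2 ^ l z := by positivity
        linarith
      have := Cube.lt_of_zpow_lt h1
      omega
    refine mem_biUnion hz ⟨hx.1, fun i => ?_, ?_⟩
    · have h1 := hwx i
      have h2 := hwz i
      have h3 : (2 : ℝ) ^ l x ≤ 2 ^ l z := zpow_le_zpow_right₀ (by norm_num) hll
      have h4 := abs_sub_le (x i) (w i) (z i)
      rw [abs_sub_comm (x i) (w i)] at h4
      simp only at h1 h2 ⊢
      rw [zpow_two_succ]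
      linarith
    · obtain ⟨k, hk, hkt⟩ := hx.2.2
      have h1 := hup z (huD hz) (l z + 1) (by omega) (by have := hlk z (huD hz); omega)
      by_cases hkl : k ≤ l z + 1
      · refine ⟨k, hkl, ?_⟩
        have := abs_sub_le (a x k) (a z (l z + 1)) (a x₀ k₀)
        linarith
      · have := hup x hx k (by omega) hk
        linarith
  have hterm : ∀ z ∈ u, ENNReal.ofReal L * μ (deviationSet μ a z (l z + 1) t) ≤
      q * ENNReal.ofReal (2 * 8 ^ n) *
        ∫⁻ y in cub z (l z), ENNReal.ofReal |f y - a x₀ k₀| ∂μ := by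
    intro z hz
    have hzD := huD hz
    have h1 := ih z hzD.1 (l z + 1)
    rw [show l z + 1 + 2 = l z + 3 by ring] at h1
    have h2 : μ (cub z (l z + 3)) ≤ ENNReal.ofReal (2 * 8 ^ n) * μ (cub z (l z)) := by
      rw [← ofReal_measureReal (h.measure_cub_ne_top z (l z)),
        ← ofReal_measureReal (h.measure_cub_ne_top z (l z + 3)),
        ← ENNReal.ofReal_mul (by positivity)]
      exact ENNReal.ofReal_le_ofReal (hgrow z hzD)
    have h3 : ENNReal.ofReal L * μ (cub z (l z)) ≤ _ :=
      ofReal_mul_measure_cub_le ha h hf hzD.1 (r := a x₀ k₀) hL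
        (by positivity : (0 : ℝ) ≤ 2 * 8 ^ n)
        ((h.real_set_mono (cub_mono (by omega))).trans (hgrow z hzD))
        (by have := hdev z hzD; linarith)
    calc ENNReal.ofReal L * μ (deviationSet μ a z (l z + 1) t)
        ≤ ENNReal.ofReal L * (q * (ENNReal.ofReal (2 * 8 ^ n) * μ (cub z (l z)))) := by
          gcongr
          exact h1.trans (by gcongr)
      _ = q * ENNReal.ofReal (2 * 8 ^ n) * (ENNReal.ofReal L * μ (cub z (l z))) := by ring
      _ ≤ _ := by gcongr
  calc ENNReal.ofReal L * μ D
      ≤ ENNReal.ofReal L * ∑' z : u, μ (deviationSet μ a z (l z + 1) t) := by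
        gcongr
        exact (measure_mono hDcov).trans (measure_biUnion_le _ hcount _)
    _ = ∑' z : u, ENNReal.ofReal L * μ (deviationSet μ a z (l z + 1) t) :=
        ENNReal.tsum_mul_left.symm
    _ ≤ ∑' z : u, q * ENNReal.ofReal (2 * 8 ^ n) *
          ∫⁻ y in cub z (l z), ENNReal.ofReal |f y - a x₀ k₀| ∂μ :=
        ENNReal.tsum_le_tsum fun z => hterm z z.2
    _ = q * ENNReal.ofReal (2 * 8 ^ n) *
          ∫⁻ y in ⋃ z ∈ u, cub z (l z), ENNReal.ofReal |f y - a x₀ k₀| ∂μ := by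
        rw [ENNReal.tsum_mul_left, lintegral_biUnion hcount (fun z _ => measurableSet_cub _ _) hdisj]
    _ ≤ q * ENNReal.ofReal (2 * 8 ^ n) *
          ∫⁻ y in cub x₀ (k₀ + 1), ENNReal.ofReal |f y - a x₀ k₀| ∂μ := by
        gcongr
        refine iUnion₂_subset fun z hz => ?_
        exact (cub_mono (hlk z (huD hz)).le).trans (cub_subset_cub_succ (huD hz).2.1)
    _ ≤ _ := by
        gcongr
        exact lintegral_abs_sub_le ha h hx₀ k₀

/-- The John–Nirenberg inequality. -/
theorem exists_measure_deviationSet_le (ha : DyadicCoeffs μ n f a K) (h : HasGrowth μ n C₀)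
    (hf : AEMeasurable f μ) :
    ∃ s : ℝ, 0 < s ∧ ∀ (j : ℕ), ∀ x₀ ∈ admissible μ, ∀ k₀ : ℤ,
      μ (deviationSet μ a x₀ k₀ (j * s)) ≤ 2⁻¹ ^ j * μ (cub x₀ (k₀ + 2)) := by
  have hK := ha.nonneg
  have hC := h.pos
  set A : ℝ := 2 * 8 ^ n * (K * (2 + C₀))
  have hA : 0 ≤ A := by positivity
  refine ⟨(2 * A + 1) + K * (2 * 8 ^ n) + K * (1 + 3 * C₀), by positivity, fun j => ?_⟩
  induction j with
  | zero =>
    intro x₀ hx₀ k₀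
    rw [pow_zero, one_mul]
    exact measure_mono fun x hx => cub_mono (by omega) hx.2.1
  | succ j ih =>
    intro x₀ hx₀ k₀
    have h1 := measure_deviationSet_succ_le ha h hf (L := 2 * A + 1) (by positivity) rfl
      (by positivity) ih hx₀ k₀
    push_cast
    rw [add_mul, one_mul]
    have hL0 : ENNReal.ofReal (2 * A + 1) ≠ 0 := by
      simpa using by positivity
    rw [← ENNReal.mul_le_mul_iff_right hL0 ENNReal.ofReal_ne_top]
    refine h1.trans ?_
    calc 2⁻¹ ^ j * ENNReal.ofReal (2 * 8 ^ n) *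
          (ENNReal.ofReal (K * (2 + C₀)) * μ (cub x₀ (k₀ + 2)))
        = 2⁻¹ ^ j * ENNReal.ofReal A * μ (cub x₀ (k₀ + 2)) := by
          rw [ENNReal.ofReal_mul (q := K * (2 + C₀)) (by positivity : (0 : ℝ) ≤ 2 * 8 ^ n)]
          ring
      _ ≤ 2⁻¹ ^ j * (ENNReal.ofReal (2 * A + 1) * 2⁻¹) * μ (cub x₀ (k₀ + 2)) := by
          gcongr
          rw [← div_eq_mul_inv, ENNReal.le_div_iff_mul_le (by simp) (by simp)]
          rw [← ENNReal.ofReal_ofNat 2, ← ENNReal.ofReal_mul hA]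
          exact ENNReal.ofReal_le_ofReal (by linarith)
      _ = _ := by rw [pow_succ]; ring

end

section

variable {d n : ℕ} {μ : Measure (Euc d)} {C₀ K : ℝ} {f : Euc d → ℝ} {a : Euc d → ℤ → ℝ}

theorem measurableSet_latCube (m : Fin d → ℤ) : MeasurableSet (latCube d m) := by
  have : latCube d m = ⋂ i, {x : Euc d | (m i : ℝ) ≤ x i ∧ x i < (m i : ℝ) + 1} := by
    ext x; simp [latCube]
  rw [this]
  refine MeasurableSet.iInter fun i => ?_
  have hi : Measurable fun x : Euc d => x i := by fun_prop
  exact (measurableSet_le measurable_const hi).inter (measurableSet_lt hi measurable_const)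

theorem pairwise_disjoint_latCube : Pairwise (Function.onFun Disjoint (latCube d)) := by
  intro m m' hmm
  rw [Function.onFun, Set.disjoint_left]
  intro x hx hx'
  refine hmm (funext fun i => ?_)
  have h1 := Int.floor_eq_iff.2 (hx i)
  rw [← h1]
  exact Int.floor_eq_iff.2 (hx' i)

theorem mem_cub_one_of_mem_latCube {m : Fin d → ℤ} {x y : Euc d} (hx : x ∈ latCube d m)
    (hy : y ∈ latCube d m) : x ∈ cub y 1 := by
  intro i
  have h1 := hx i
  have h2 := hy i
  simp only [zpow_one]
  rw [abs_le]
  constructor <;> linarith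

theorem measure_inter_latCube_le (h : HasGrowth μ n C₀) {E : Set (Euc d)} {m : Fin d → ℤ}
    {q : ℝ≥0∞} (hE : E ⊆ admissible μ)
    (hm : ∀ x₀ ∈ admissible μ, x₀ ∈ latCube d m → μ (E ∩ latCube d m) ≤ q * μ (cub x₀ 3)) :
    μ (E ∩ latCube d m) ≤ q * ENNReal.ofReal (C₀ * 8 ^ n) := by
  by_cases hne : ∃ x₀ ∈ admissible μ, x₀ ∈ latCube d m
  · obtain ⟨x₀, hx₀, hx₀m⟩ := hne
    refine (hm x₀ hx₀ hx₀m).trans ?_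
    gcongr
    have := h.cube ⟨x₀, (2 : ℝ) ^ (3 : ℤ)⟩ ⟨by norm_num, hx₀⟩
    have e : ((2 : ℝ) ^ (3 : ℤ)) = 8 := by norm_num
    rw [cub, e]
    rwa [e] at this
  · push Not at hne
    have : E ∩ latCube d m = ∅ := by
      ext x
      simp only [mem_inter_iff, mem_empty_iff_false, iff_false, not_and]
      exact fun hx => hne x (hE hx)
    simp [this]

theorem measure_latCube_le (h : HasGrowth μ n C₀) (m : Fin d → ℤ) :
    μ (latCube d m) ≤ ENNReal.ofReal (C₀ * 8 ^ n) := by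
  have h1 := measure_inter_latCube_le (q := 1) (m := m) h (subset_refl (admissible μ))
    fun x₀ _ hx₀m => by
      rw [one_mul]
      exact measure_mono fun x hx => cub_mono (by norm_num) (mem_cub_one_of_mem_latCube hx.2 hx₀m)
  rw [one_mul] at h1
  refine le_trans ?_ h1
  calc μ (latCube d m) ≤ μ ((admissible μ ∩ latCube d m) ∪ (admissible μ)ᶜ) := by
        refine measure_mono fun x hx => ?_
        by_cases hxa : x ∈ admissible μ
        · exact Or.inl ⟨hxa, hx⟩
        · exact Or.inr hxa
    _ ≤ _ := (measure_union_le _ _).trans (by rw [measure_compl_admissible, add_zero])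

/-- Local exponential integrability of the maximal function `sup_k |a x k|`. -/
theorem exists_exp_majorant (ha : DyadicCoeffs μ n f a K) (h : HasGrowth μ n C₀)
    (hf : AEMeasurable f μ) :
    ∃ (κ : ℝ) (A : ℝ≥0∞) (W : Euc d → ℝ≥0∞), 0 < κ ∧ A ≠ ⊤ ∧ Measurable W ∧
      (∀ x ∈ admissible μ, ∀ k, ENNReal.ofReal (Real.exp (κ * |a x k|)) ≤ W x) ∧
      ∀ m, ∫⁻ x in latCube d m, W x ∂μ ≤ A := by
  have := h.isLocallyFiniteMeasure
  have hK := ha.nonneg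
  obtain ⟨s, hs, hJN⟩ := exists_measure_deviationSet_le ha h hf
  set κ : ℝ := Real.log (3 / 2) / s
  have hκ : 0 < κ := div_pos (Real.log_pos (by norm_num)) hs
  have hκs : Real.exp (κ * s) = 3 / 2 := by
    rw [div_mul_cancel₀ _ hs.ne', Real.exp_log (by norm_num)]
  set E : ℕ → Set (Euc d) := fun j => {x | x ∈ admissible μ ∧ ∃ k, 2 * K + j * s < |a x k|}
  have hE : ∀ j m, μ (E j ∩ latCube d m) ≤ 2⁻¹ ^ j * ENNReal.ofReal (C₀ * 8 ^ n) := by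
    intro j m
    refine measure_inter_latCube_le h (fun x hx => hx.1) fun x₀ hx₀ hx₀m => ?_
    refine (measure_mono ?_).trans (hJN j x₀ hx₀ 1)
    rintro x ⟨⟨hxa, k, hk⟩, hxm⟩
    refine ⟨hxa, mem_cub_one_of_mem_latCube hxm hx₀m, k, ?_, ?_⟩
    · by_contra! hc
      have := ha.large x hxa k hc.le
      have : 0 ≤ j * s := by positivity
      linarith
    · have h1 := ha.large x₀ hx₀ 1 le_rfl
      have h2 := abs_sub_abs_le_abs_sub (a x k) (a x₀ 1)
      linarith
  set r : ℝ≥0∞ := ENNReal.ofReal (3 / 2)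
  set w : ℝ≥0∞ := ENNReal.ofReal (Real.exp (κ * (2 * K)))
  set V : ℝ≥0∞ := ENNReal.ofReal (C₀ * 8 ^ n)
  have hEm : ∀ j, Measurable ((toMeasurable μ (E j)).indicator fun _ => r ^ (j + 1)) := fun j =>
    measurable_const.indicator (measurableSet_toMeasurable _ _)
  refine ⟨κ, w * (V + r * V * ∑' j : ℕ, (r * 2⁻¹) ^ j),
    fun x => w * (1 + ∑' j, (toMeasurable μ (E j)).indicator (fun _ => r ^ (j + 1)) x),
    hκ, ?_, ?_, ?_, ?_⟩
  · have hr : r * 2⁻¹ < 1 := by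
      rw [← div_eq_mul_inv]
      refine ENNReal.div_lt_of_lt_mul ?_
      rw [one_mul, ← ENNReal.ofReal_ofNat 2]
      exact (ENNReal.ofReal_lt_ofReal_iff (by norm_num)).2 (by norm_num)
    have h2 : ∑' j : ℕ, (r * 2⁻¹) ^ j ≠ ⊤ := by
      rw [ENNReal.tsum_geometric]
      exact ENNReal.inv_ne_top.2 (tsub_pos_of_lt hr).ne'
    exact ENNReal.mul_ne_top ENNReal.ofReal_ne_top (ENNReal.add_ne_top.2 ⟨ENNReal.ofReal_ne_top,
      ENNReal.mul_ne_top (ENNReal.mul_ne_top ENNReal.ofReal_ne_top ENNReal.ofReal_ne_top) h2⟩)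
  · exact (measurable_const.add (Measurable.tsum hEm)).const_mul _
  · intro x hx k
    by_cases hk : |a x k| ≤ 2 * K
    · calc _ ≤ w := ENNReal.ofReal_le_ofReal (Real.exp_le_exp.2 (by gcongr))
        _ = w * 1 := (mul_one _).symm
        _ ≤ _ := mul_le_mul_right le_self_add _
    · push Not at hk
      set j := ⌈(|a x k| - 2 * K) / s⌉₊ - 1 with hj
      have hpos : 0 < (|a x k| - 2 * K) / s := div_pos (by linarith) hs
      have hceil : 0 < ⌈(|a x k| - 2 * K) / s⌉₊ := Nat.ceil_pos.2 hpos
      have hj1 : 2 * K + j * s < |a x k| := by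
        have : (j : ℝ) < (|a x k| - 2 * K) / s := Nat.lt_ceil.1 (by omega)
        rw [lt_div_iff₀ hs] at this
        linarith
      have hj2 : |a x k| ≤ 2 * K + (j + 1 : ℕ) * s := by
        have : (|a x k| - 2 * K) / s ≤ (j + 1 : ℕ) := (Nat.le_ceil _).trans (by
          exact_mod_cast (by omega))
        rw [div_le_iff₀ hs] at this
        linarith
      have hxE : x ∈ toMeasurable μ (E j) := subset_toMeasurable _ _ ⟨hx, k, hj1⟩
      calc ENNReal.ofReal (Real.exp (κ * |a x k|))
          ≤ ENNReal.ofReal (Real.exp (κ * (2 * K)) * (3 / 2) ^ (j + 1)) := by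
            refine ENNReal.ofReal_le_ofReal ?_
            rw [← hκs, ← Real.exp_nat_mul, ← Real.exp_add, Real.exp_le_exp]
            calc κ * |a x k| ≤ κ * (2 * K + (j + 1 : ℕ) * s) := by gcongr
              _ = _ := by ring
        _ = w * (toMeasurable μ (E j)).indicator (fun _ => r ^ (j + 1)) x := by
            rw [indicator_of_mem hxE, ENNReal.ofReal_mul (Real.exp_nonneg _),
              ENNReal.ofReal_pow (by norm_num)]
        _ ≤ _ := mul_le_mul_right ((ENNReal.le_tsum (f := fun j =>
              (toMeasurable μ (E j)).indicator (fun _ => r ^ (j + 1)) x) j).trans le_add_self) _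
  · intro m
    have hterm : ∀ j, ∫⁻ x in latCube d m,
        (toMeasurable μ (E j)).indicator (fun _ => r ^ (j + 1)) x ∂μ ≤
          r * V * (r * 2⁻¹) ^ j := by
      intro j
      rw [lintegral_indicator_const (measurableSet_toMeasurable _ _),
        Measure.restrict_apply (measurableSet_toMeasurable _ _),
        Measure.measure_toMeasurable_inter_of_sFinite (measurableSet_latCube m)]
      calc r ^ (j + 1) * μ (E j ∩ latCube d m) ≤ r ^ (j + 1) * (2⁻¹ ^ j * V) := by
            gcongr; exact hE j m
        _ = _ := by rw [mul_pow, pow_succ]; ring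
    calc ∫⁻ x in latCube d m, w * (1 + ∑' j,
          (toMeasurable μ (E j)).indicator (fun _ => r ^ (j + 1)) x) ∂μ
        = w * (μ (latCube d m) + ∑' j, ∫⁻ x in latCube d m,
            (toMeasurable μ (E j)).indicator (fun _ => r ^ (j + 1)) x ∂μ) := by
          rw [lintegral_const_mul' _ _ ENNReal.ofReal_ne_top,
            lintegral_add_left measurable_const, setLIntegral_const, one_mul,
            lintegral_tsum fun j => (hEm j).aemeasurable]
      _ ≤ _ := by
          rw [← ENNReal.tsum_mul_left]
          gcongr with j
          · exact measure_latCube_le h m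
          · exact hterm j

end

/-! ### The Orlicz function `℘` and exponentially integrable factors -/

theorem wp_mul_le {s t θ : ℝ} (hs : 0 ≤ s) (ht : 0 ≤ t) (hθ : 0 < θ) :
    wp (s * t) ≤ (2 + 4 / θ) * s + θ * Real.exp t := by
  have hst : 0 ≤ s * t := by positivity
  have hlog1 : 1 ≤ Real.log (Real.exp 1 + s * t) := by
    rw [Real.le_log_iff_exp_le (by positivity)]
    linarith
  have hA : 0 ≤ 4 / θ * s := by positivity
  have hB : 0 ≤ θ * Real.exp t := by positivity
  unfold wp
  rcases le_or_gt (Real.exp (t / 2)) s with h | h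
  · have key : t ≤ 2 * Real.log (Real.exp 1 + s * t) := by
      rcases le_or_gt t 1 with h1 | h1
      · linarith
      · have : t / 2 ≤ Real.log (Real.exp 1 + s * t) := by
          rw [Real.le_log_iff_exp_le (by positivity)]
          have := Real.exp_pos 1
          nlinarith [Real.exp_pos (t / 2)]
        linarith
    have : s * t / Real.log (Real.exp 1 + s * t) ≤ 2 * s := by
      rw [div_le_iff₀ (by linarith)]
      nlinarith
    linarith
  · have h1 : s * t / Real.log (Real.exp 1 + s * t) ≤ s * t := div_le_self hst hlog1
    have h2 : t ≤ 4 * Real.exp (t / 4) := by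
      have := Real.add_one_le_exp (t / 4)
      linarith
    set r := Real.sqrt s
    have hr : 0 ≤ r := Real.sqrt_nonneg _
    have hrs : r * r = s := Real.mul_self_sqrt hs
    have e4 : Real.exp (t / 2) = Real.exp (t / 4) * Real.exp (t / 4) := by
      rw [← Real.exp_add]; ring_nf
    have e2 : Real.exp t = Real.exp (t / 2) * Real.exp (t / 2) := by
      rw [← Real.exp_add]; ring_nf
    have h3 : r ≤ Real.exp (t / 4) := by
      refine abs_le_of_sq_le_sq' ?_ (Real.exp_nonneg _) |>.2
      rw [sq, sq, hrs, ← e4]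
      exact h.le
    have h4 : s * t ≤ 4 * r * Real.exp (t / 2) := by
      calc s * t = r * (r * t) := by rw [← mul_assoc, hrs]
        _ ≤ r * (Real.exp (t / 4) * (4 * Real.exp (t / 4))) := by gcongr
        _ = _ := by rw [e4]; ring
    have h5 : 4 * r * Real.exp (t / 2) ≤ 4 / θ * s + θ * Real.exp t := by
      have h6 : 4 / θ * s + θ * Real.exp t - 4 * r * Real.exp (t / 2) =
          (2 * r - θ * Real.exp (t / 2)) ^ 2 / θ := by
        rw [e2, ← hrs]
        field_simp
        ring
      have h7 : 0 ≤ (2 * r - θ * Real.exp (t / 2)) ^ 2 / θ := by positivity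
      linarith
    linarith

theorem wp_le_of_le_mul {v s t θ : ℝ} (hv : 0 ≤ v) (hs : 0 ≤ s) (ht : 0 ≤ t) (hθ : 0 < θ)
    (h : v ≤ s * t) : wp v ≤ (2 + 4 / θ) * s + θ * Real.exp t := by
  rcases ht.eq_or_lt with rfl | ht'
  · have : v = 0 := le_antisymm (by simpa using h) hv
    rw [this]
    simp only [wp, zero_div]
    positivity
  · have h1 : v / t ≤ s := by rwa [div_le_iff₀ ht']
    have h2 := wp_mul_le (s := v / t) (t := t) (by positivity) ht hθ
    rw [div_mul_cancel₀ _ ht'.ne'] at h2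
    refine h2.trans ?_
    gcongr

/-- A product of an exponentially integrable function and an integrable one is in `L^℘`, with a
bound that is linear in the integral of the second factor. -/
theorem exists_orliczNormOn_wp_le {α : Type*} [MeasurableSpace α] (μ : Measure α) {κ C : ℝ}
    {A : ℝ≥0∞} (hκ : 0 < κ) (hC : 0 ≤ C) (hA : A ≠ ⊤) :
    ∃ D : ℝ≥0∞, D ≠ ⊤ ∧ ∀ (E : Set α) (W G : α → ℝ≥0∞) (u : α → ℝ), Measurable W → Measurable G →
      ∫⁻ x in E, W x ∂μ ≤ A →
      (∀ᵐ x ∂μ.restrict E, ∃ T : ℝ, 0 ≤ T ∧ ENNReal.ofReal (Real.exp (κ * T)) ≤ W x ∧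
        ENNReal.ofReal |u x| ≤ ENNReal.ofReal (T + C) * G x) →
      orliczNormOn wp μ E u ≤ D * ∫⁻ x in E, G x ∂μ := by
  set A' := A.toReal
  set θ : ℝ := (2 * Real.exp (κ * C) * (A' + 1))⁻¹
  have hA' : 0 ≤ A' := ENNReal.toReal_nonneg
  have hθ : 0 < θ := by positivity
  have hθA : θ * Real.exp (κ * C) * A' ≤ 1 / 2 := by
    have : θ * Real.exp (κ * C) * A' = A' / (A' + 1) / 2 := by
      simp only [θ]
      field_simp
    rw [this]
    have : A' / (A' + 1) ≤ 1 := by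
      rw [div_le_one (by positivity)]
      linarith
    linarith
  set c₁ : ℝ := (2 + 4 / θ) / κ
  have hc₁ : 0 < c₁ := by positivity
  refine ⟨ENNReal.ofReal (2 * c₁), ENNReal.ofReal_ne_top, fun E W G u hW hG hWA hu => ?_⟩
  refine le_of_forall_gt_imp_ge_of_dense fun k hk => ?_
  rcases eq_or_ne k ⊤ with rfl | hk'
  · exact le_top
  have hk0 : 0 < k := bot_le.trans_lt hk
  have hkr : 0 < k.toReal := ENNReal.toReal_pos hk0.ne' hk'
  refine sInf_le ⟨hk0, hk', ?_⟩
  have hpt : ∀ᵐ x ∂μ.restrict E, ENNReal.ofReal (wp (|u x| / k.toReal)) ≤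
      ENNReal.ofReal (c₁ / k.toReal) * G x + ENNReal.ofReal (θ * Real.exp (κ * C)) * W x := by
    filter_upwards [hu] with x hx
    obtain ⟨T, hT, hTW, hTu⟩ := hx
    rcases eq_or_ne (G x) ⊤ with hGx | hGx
    · rw [hGx, ENNReal.mul_top (by simpa using by positivity), top_add]
      exact le_top
    lift G x to ℝ≥0 using hGx with g
    rw [← ENNReal.ofReal_coe_nnreal, ← ENNReal.ofReal_mul (by positivity),
      ENNReal.ofReal_le_ofReal_iff (by positivity)] at hTu
    have h1 : |u x| / k.toReal ≤ (g / (κ * k.toReal)) * (κ * (T + C)) := by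
      rw [div_le_iff₀ hkr]
      refine hTu.trans (le_of_eq ?_)
      field_simp
    have h2 := wp_le_of_le_mul (by positivity) (by positivity) (by positivity) hθ h1
    calc ENNReal.ofReal (wp (|u x| / k.toReal))
        ≤ ENNReal.ofReal (c₁ / k.toReal * g + θ * Real.exp (κ * C) * Real.exp (κ * T)) := by
          refine ENNReal.ofReal_le_ofReal (h2.trans (le_of_eq ?_))
          simp only [c₁]
          rw [mul_add κ T C, Real.exp_add]
          field_simp
      _ = ENNReal.ofReal (c₁ / k.toReal) * g +
            ENNReal.ofReal (θ * Real.exp (κ * C)) * ENNReal.ofReal (Real.exp (κ * T)) := by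
          rw [ENNReal.ofReal_add (by positivity) (by positivity), ENNReal.ofReal_mul (by positivity),
            ENNReal.ofReal_mul (p := θ * Real.exp (κ * C)) (by positivity),
            ENNReal.ofReal_coe_nnreal]
      _ ≤ _ := by gcongr
  calc ∫⁻ x in E, ENNReal.ofReal (wp (|u x| / k.toReal)) ∂μ
      ≤ ∫⁻ x in E, (ENNReal.ofReal (c₁ / k.toReal) * G x +
          ENNReal.ofReal (θ * Real.exp (κ * C)) * W x) ∂μ := lintegral_mono_ae hpt
    _ = ENNReal.ofReal (c₁ / k.toReal) * ∫⁻ x in E, G x ∂μ +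
          ENNReal.ofReal (θ * Real.exp (κ * C)) * ∫⁻ x in E, W x ∂μ := by
        rw [lintegral_add_left (hG.const_mul _), lintegral_const_mul _ hG, lintegral_const_mul _ hW]
    _ ≤ ENNReal.ofReal (1 / 2) + ENNReal.ofReal (1 / 2) := by
        gcongr
        · have h3 : ENNReal.ofReal (c₁ / k.toReal) =
              ENNReal.ofReal (2 * c₁) * ENNReal.ofReal (1 / 2) * (ENNReal.ofReal k.toReal)⁻¹ := by
            rw [← ENNReal.ofReal_inv_of_pos hkr, ← ENNReal.ofReal_mul (by positivity),
              ← ENNReal.ofReal_mul (by positivity)]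
            congr 1
            field_simp
          rw [h3, ENNReal.ofReal_toReal hk']
          calc ENNReal.ofReal (2 * c₁) * ENNReal.ofReal (1 / 2) * k⁻¹ * ∫⁻ x in E, G x ∂μ
              = ENNReal.ofReal (1 / 2) * (k⁻¹ * (ENNReal.ofReal (2 * c₁) * ∫⁻ x in E, G x ∂μ)) := by
                ring
            _ ≤ ENNReal.ofReal (1 / 2) * (k⁻¹ * k) := by gcongr
            _ = _ := by rw [ENNReal.inv_mul_cancel hk0.ne' hk', mul_one]
        · calc ENNReal.ofReal (θ * Real.exp (κ * C)) * ∫⁻ x in E, W x ∂μ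
              ≤ ENNReal.ofReal (θ * Real.exp (κ * C)) * ENNReal.ofReal A' := by
                rw [ENNReal.ofReal_toReal hA]
                gcongr
            _ ≤ _ := by
                rw [← ENNReal.ofReal_mul (by positivity)]
                exact ENNReal.ofReal_le_ofReal hθA
    _ = 1 := by
        rw [← ENNReal.ofReal_add (by norm_num) (by norm_num)]
        norm_num

/-! ### Test functions and blocks -/

theorem TestFunLoc.hasCompactSupport {d n : ℕ} {μ : Measure (Euc d)} {x : Euc d} {φ : Euc d → ℝ}
    (hφ : TestFunLoc μ n x φ) : HasCompactSupport φ :=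
  HasCompactSupport.intro (Cube.isCompact_set ⟨x, 1⟩) fun y hy => by
    by_contra hne
    exact hy (hφ.2 hne)

theorem TestFun.lintegral_le_one {d n : ℕ} {μ : Measure (Euc d)} {x : Euc d} {φ : Euc d → ℝ}
    (hφ : TestFun μ n x φ) : ∫⁻ y, ENNReal.ofReal (φ y) ∂μ ≤ 1 := by
  rw [← ofReal_integral_eq_lintegral_ofReal hφ.1 (ae_of_all _ hφ.2.2.2.1), ← ENNReal.ofReal_one]
  refine ENNReal.ofReal_le_ofReal (le_trans (le_of_eq ?_) hφ.2.2.1)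
  exact integral_congr_ae (ae_of_all _ fun y => (abs_of_nonneg (hφ.2.2.2.1 y)).symm)

theorem TestFun.le_of_le_norm {d n : ℕ} {μ : Measure (Euc d)} {x y : Euc d} {φ : Euc d → ℝ}
    (hφ : TestFun μ n x φ) {ρ : ℝ} (hρ : 0 < ρ) (hy : ρ ≤ ‖y - x‖) : φ y ≤ (ρ ^ n)⁻¹ := by
  have hyx : y ≠ x := by
    rintro rfl
    simp at hy
    linarith
  refine (hφ.2.2.2.2.1 y hyx).trans ?_
  gcongr

theorem TestFun.fderiv_le_of_le_norm {d n : ℕ} {μ : Measure (Euc d)} {x y : Euc d}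
    {φ : Euc d → ℝ} (hφ : TestFun μ n x φ) {ρ : ℝ} (hρ : 0 < ρ) (hy : ρ ≤ ‖y - x‖) :
    ‖fderiv ℝ φ y‖ ≤ (ρ ^ (n + 1))⁻¹ := by
  have hyx : y ≠ x := by
    rintro rfl
    simp at hy
    linarith
  refine (hφ.2.2.2.2.2 y hyx).trans ?_
  gcongr

theorem Cube.le_norm_sub {d : ℕ} {x y z : Euc d} {r s : ℝ} (hx : x ∉ (Cube.mk z s).set)
    (hy : y ∈ (Cube.mk z r).set) : (s - r) / 2 ≤ ‖y - x‖ := by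
  simp only [Cube.set, mem_ofPred_eq, not_forall, not_le] at hx
  obtain ⟨i, hi⟩ := hx
  have h1 := hy i
  have h2 : |y i - x i| ≤ ‖y - x‖ := PiLp.norm_apply_le (y - x) i
  have h3 := abs_sub_le (x i) (y i) (z i)
  rw [abs_sub_comm (x i) (y i)] at h3
  simp only at h1
  linarith

theorem exists_scale_le_norm_sub {d : ℕ} {x z : Euc d} {r : ℝ} (hr : 0 < r) {l : ℤ}
    (hx : x ∉ (Cube.mk z (2 * r)).set) (hxl : x ∈ cub z (l + 1)) (hl : Cube.scale r ≤ l) :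
    ∃ k ∈ Finset.Ico (Cube.scale r) (l + 1), x ∈ cub z (k + 1) ∧
      ∀ y ∈ (Cube.mk z r).set, (2 : ℝ) ^ k / 4 ≤ ‖y - x‖ := by
  obtain ⟨k, ⟨hk, hxk⟩, hmin⟩ := Int.exists_least_of_bdd
    (P := fun k => Cube.scale r ≤ k ∧ x ∈ cub z (k + 1)) ⟨Cube.scale r, fun z hz => hz.1⟩
    ⟨l, hl, hxl⟩
  refine ⟨k, Finset.mem_Ico.2 ⟨hk, by have := hmin l ⟨hl, hxl⟩; omega⟩, hxk, fun y hy => ?_⟩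
  rcases hk.eq_or_lt with rfl | hlt
  · have h1 := Cube.le_norm_sub hx hy
    have h2 := Cube.zpow_scale_lt hr
    linarith
  · have hx' : x ∉ cub z k := by
      intro hc
      have := hmin (k - 1) ⟨by omega, by rwa [sub_add_cancel]⟩
      omega
    have h1 := Cube.le_norm_sub hx' hy
    have h2 := Cube.le_zpow_scale r
    have h3 : (2 : ℝ) ^ (Cube.scale r + 1) ≤ 2 ^ k := zpow_le_zpow_right₀ (by norm_num) (by omega)
    rw [zpow_two_succ] at h3
    linarith

namespace PreBlock

variable {d n : ℕ} {μ : Measure (Euc d)} {C₀ K : ℝ}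

theorem measurable_fn (b : PreBlock μ n) : Measurable b.fn :=
  Measurable.tsum fun i => (b.measA i).const_mul _

theorem fn_eq_zero (b : PreBlock μ n) {x : Euc d} (hx : x ∉ b.R.set) : b.fn x = 0 := by
  have : ∀ i, b.lam i * b.a i x = 0 := fun i => by
    have : b.a i x = 0 := by
      by_contra hne
      exact hx (b.subsetQR i (b.suppA i hne))
    rw [this, mul_zero]
  simp [fn, this]

theorem lintegral_fn_mul_le (b : PreBlock μ n) {φ : Euc d → ℝ≥0∞} (hφ : Measurable φ) :
    ∫⁻ y, ENNReal.ofReal |b.fn y| * φ y ∂μ ≤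
      ∑' i, ENNReal.ofReal |b.lam i| *
        (ENNReal.ofReal (b.height i) * ∫⁻ y in (b.Qs i).set, φ y ∂μ) := by
  have hm : ∀ i, Measurable fun y => ENNReal.ofReal |b.a i y| := fun i =>
    (b.measA i).abs.ennreal_ofReal
  calc ∫⁻ y, ENNReal.ofReal |b.fn y| * φ y ∂μ
      ≤ ∫⁻ y, ∑' i, ENNReal.ofReal |b.lam i| * (ENNReal.ofReal |b.a i y| * φ y) ∂μ := by
        refine lintegral_mono fun y => ?_
        refine (mul_le_mul_left (ofReal_abs_tsum_le _) _).trans ?_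
        rw [← ENNReal.tsum_mul_right]
        refine ENNReal.tsum_le_tsum fun i => le_of_eq ?_
        rw [abs_mul, ENNReal.ofReal_mul (abs_nonneg _), mul_assoc]
    _ = ∑' i, ENNReal.ofReal |b.lam i| * ∫⁻ y, ENNReal.ofReal |b.a i y| * φ y ∂μ := by
        have hm' : ∀ i, Measurable fun y => ENNReal.ofReal |b.a i y| * φ y := fun i =>
          (hm i).mul hφ
        rw [lintegral_tsum fun i => ((hm' i).const_mul _).aemeasurable]
        exact tsum_congr fun i => lintegral_const_mul' _ _ ENNReal.ofReal_ne_top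
    _ ≤ _ := by
        refine ENNReal.tsum_le_tsum fun i => mul_le_mul_right ?_ _
        rw [← lintegral_const_mul' _ _ ENNReal.ofReal_ne_top, ← lintegral_indicator
          (b.Qs i).measurableSet_set]
        refine lintegral_mono fun y => ?_
        by_cases hy : y ∈ (b.Qs i).set
        · rw [indicator_of_mem hy]
          gcongr
          exact b.abs_a_le i y
        · have : b.a i y = 0 := by
            by_contra hne
            exact hy (b.suppA i hne)
          simp [this]

theorem lintegral_fn_le (h : HasGrowth μ n C₀) (b : PreBlock μ n) :
    ∫⁻ y, ENNReal.ofReal |b.fn y| ∂μ ≤ ENNReal.ofReal b.size := by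
  have h1 := b.lintegral_fn_mul_le (φ := fun _ => 1) measurable_const
  simp only [mul_one, setLIntegral_one] at h1
  refine h1.trans ?_
  rw [← b.tsum_ofReal_lam]
  refine ENNReal.tsum_le_tsum fun i => ?_
  refine mul_le_of_le_one_right' ?_
  rw [← ofReal_measureReal (h.measure_set_ne_top _), ← ENNReal.ofReal_mul (b.height_nonneg i),
    ← ENNReal.ofReal_one]
  refine ENNReal.ofReal_le_ofReal (le_trans ?_ (b.height_mul_le_one h i))
  exact mul_le_mul_of_nonneg_left (b.real_le_real_double h i) (b.height_nonneg i)

theorem integrable_fn (h : HasGrowth μ n C₀) (b : PreBlock μ n) : Integrable b.fn μ := by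
  refine ⟨b.measurable_fn.aestronglyMeasurable, ?_⟩
  simp only [HasFiniteIntegral, Real.enorm_eq_ofReal_abs]
  exact (b.lintegral_fn_le h).trans_lt ENNReal.ofReal_lt_top

theorem integrable_fn_mul (h : HasGrowth μ n C₀) (b : PreBlock μ n) {x : Euc d} {φ : Euc d → ℝ}
    (hφ : TestFunLoc μ n x φ) : Integrable (fun y => b.fn y * φ y) μ := by
  obtain ⟨C, hC⟩ := hφ.hasCompactSupport.exists_bound_of_continuous hφ.1.2.1.continuous
  exact (b.integrable_fn h).mul_bdd (c := C) hφ.1.2.1.continuous.aestronglyMeasurable (ae_of_all _ hC)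

/-- The part of the majorant of a block that controls it near its cube. -/
def nearMajorant (b : PreBlock μ n) (x : Euc d) : ℝ≥0∞ :=
  ∑' i, ENNReal.ofReal |b.lam i| * (ENNReal.ofReal (b.height i) *
    ((Cube.mk (b.Qs i).center (2 * (b.Qs i).side)).set.indicator 1 x +
      ∑ k ∈ Finset.Ico (Cube.scale (b.Qs i).side) (Cube.scale b.R.side + 3),
        (cub (b.Qs i).center (k + 1)).indicator
          (fun _ => ENNReal.ofReal (((2 : ℝ) ^ k / 4) ^ n)⁻¹ * μ (b.Qs i).set) x))

theorem measurable_nearMajorant (b : PreBlock μ n) : Measurable b.nearMajorant := by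
  refine Measurable.tsum fun i => (Measurable.const_mul (Measurable.add ?_ ?_) _).const_mul _
  · exact measurable_one.indicator (Cube.measurableSet_set _)
  · exact Finset.measurable_sum _ fun k _ => measurable_const.indicator (measurableSet_cub _ _)

theorem lintegral_nearMajorant_le (h : HasGrowth μ n C₀) (b : PreBlock μ n) :
    ∫⁻ x, b.nearMajorant x ∂μ ≤
      ENNReal.ofReal (1 + 8 ^ n * (2 ^ n + 4 * C₀)) * ENNReal.ofReal b.size := by
  have hC := h.pos
  have hmeas : ∀ i, Measurable fun x =>
      ∑ k ∈ Finset.Ico (Cube.scale (b.Qs i).side) (Cube.scale b.R.side + 3),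
        (cub (b.Qs i).center (k + 1)).indicator
          (fun _ => ENNReal.ofReal (((2 : ℝ) ^ k / 4) ^ n)⁻¹ * μ (b.Qs i).set) x := fun i =>
    Finset.measurable_sum _ fun k _ => measurable_const.indicator (measurableSet_cub _ _)
  have hmeas' : ∀ i, Measurable fun x => ENNReal.ofReal (b.height i) *
      ((Cube.mk (b.Qs i).center (2 * (b.Qs i).side)).set.indicator 1 x +
      ∑ k ∈ Finset.Ico (Cube.scale (b.Qs i).side) (Cube.scale b.R.side + 3),
        (cub (b.Qs i).center (k + 1)).indicator
          (fun _ => ENNReal.ofReal (((2 : ℝ) ^ k / 4) ^ n)⁻¹ * μ (b.Qs i).set) x) := fun i =>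
    ((measurable_one.indicator (Cube.measurableSet_set _)).add (hmeas i)).const_mul _
  unfold nearMajorant
  rw [lintegral_tsum fun i => ((hmeas' i).const_mul _).aemeasurable, ← b.tsum_ofReal_lam,
    ← ENNReal.tsum_mul_left]
  refine ENNReal.tsum_le_tsum fun i => ?_
  rw [lintegral_const_mul' _ _ ENNReal.ofReal_ne_top, mul_comm]
  refine mul_le_mul_left ?_ _
  set Q := b.Qs i
  set e := Cube.scale Q.side
  set e' := Cube.scale b.R.side
  set S := SQR μ n Q b.R
  have hQ := b.isCubeQs i
  have hα := b.height_nonneg i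
  have h1 : b.height i * μ.real (Cube.mk Q.center (2 * Q.side)).set ≤ 1 := b.height_mul_le_one h i
  have h2 : b.height i * μ.real Q.set * S ≤ 1 := b.height_mul_mul_SQR_le h i
  have hS : 1 ≤ S := one_le_SQR hQ.1
  have h3 : b.height i * μ.real Q.set ≤ 1 := by
    have : 0 ≤ b.height i * μ.real Q.set := by positivity
    nlinarith
  have hsum : ∑ k ∈ Finset.Ico e (e' + 3), ENNReal.ofReal (((2 : ℝ) ^ k / 4) ^ n)⁻¹ * μ Q.set *
      μ (cub Q.center (k + 1)) ≤ ENNReal.ofReal (μ.real Q.set * (8 ^ n * (2 ^ n * S + 4 * C₀))) := by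
    calc _ = ENNReal.ofReal (∑ k ∈ Finset.Ico e (e' + 3),
          μ.real Q.set * (8 ^ n * theta μ n Q.center (k + 1))) := by
          rw [ENNReal.ofReal_sum_of_nonneg fun k _ => by
            have := theta_nonneg (μ := μ) (n := n) Q.center (k + 1)
            positivity]
          refine Finset.sum_congr rfl fun k _ => ?_
          rw [← ofReal_measureReal (h.measure_set_ne_top Q),
            ← ofReal_measureReal (h.measure_cub_ne_top Q.center (k + 1)),
            ← ENNReal.ofReal_mul (by positivity), ← ENNReal.ofReal_mul (by positivity)]
          congr 1
          rw [theta, zpow_two_succ, div_pow, mul_pow, show (8 : ℝ) = 4 * 2 by norm_num, mul_pow]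
          field_simp
      _ ≤ _ := by
          refine ENNReal.ofReal_le_ofReal ?_
          rw [← Finset.mul_sum, ← Finset.mul_sum, sum_theta_succ]
          gcongr
          have h4 := sig_le_SQR h hQ.1 b.isCubeR.1
          have h5 := sig_succ_le h hQ.2 e e' 4
          have h6 : sig μ n Q.center (e + 1) (e' + 3 + 1) ≤ sig μ n Q.center e (e' + (4 : ℕ)) :=
            sig_mono _ (by omega) (by omega)
          push_cast at h5 h6
          linarith
  rw [lintegral_const_mul' _ _ ENNReal.ofReal_ne_top, lintegral_add_right _ (hmeas i),
    lintegral_indicator_one (Cube.measurableSet_set _), lintegral_finsetSum _ fun k _ =>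
      measurable_const.indicator (measurableSet_cub _ _)]
  simp only [lintegral_indicator_const (measurableSet_cub _ _)]
  calc ENNReal.ofReal (b.height i) * (μ (Cube.mk Q.center (2 * Q.side)).set +
          ∑ k ∈ Finset.Ico e (e' + 3), ENNReal.ofReal (((2 : ℝ) ^ k / 4) ^ n)⁻¹ * μ Q.set *
            μ (cub Q.center (k + 1)))
    _ ≤ ENNReal.ofReal (b.height i) *
          (ENNReal.ofReal (μ.real (Cube.mk Q.center (2 * Q.side)).set) +
            ENNReal.ofReal (μ.real Q.set * (8 ^ n * (2 ^ n * S + 4 * C₀)))) := by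
        rw [ofReal_measureReal (h.measure_set_ne_top _)]
        gcongr
    _ ≤ _ := by
        rw [← ENNReal.ofReal_add measureReal_nonneg (by positivity), ← ENNReal.ofReal_mul hα]
        refine ENNReal.ofReal_le_ofReal ?_
        calc _ = b.height i * μ.real (Cube.mk Q.center (2 * Q.side)).set +
              8 ^ n * (2 ^ n * (b.height i * μ.real Q.set * S) +
                4 * C₀ * (b.height i * μ.real Q.set)) := by ring
          _ ≤ 1 + 8 ^ n * (2 ^ n * 1 + 4 * C₀ * 1) := by gcongr
          _ = _ := by ring

theorem lintegral_fn_mul_le_nearMajorant (b : PreBlock μ n) {x : Euc d} {φ : Euc d → ℝ}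
    (hd : 0 < d) (hφ : TestFun μ n x φ) (hx : x ∈ cub b.R.center (Cube.scale b.R.side + 2)) :
    ∫⁻ y, ENNReal.ofReal |b.fn y| * ENNReal.ofReal (φ y) ∂μ ≤ b.nearMajorant x := by
  refine (b.lintegral_fn_mul_le hφ.2.1.continuous.measurable.ennreal_ofReal).trans ?_
  refine ENNReal.tsum_le_tsum fun i => mul_le_mul_right (mul_le_mul_right ?_ _) _
  set Q := b.Qs i
  have hQ := b.isCubeQs i
  by_cases hxQ : x ∈ (Cube.mk Q.center (2 * Q.side)).set
  · rw [indicator_of_mem hxQ, Pi.one_apply]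
    exact (setLIntegral_le_lintegral _ _).trans (hφ.lintegral_le_one.trans le_self_add)
  · have hxl : x ∈ cub Q.center (Cube.scale b.R.side + 2 + 1) := by
      have h1 : Q.center ∈ cub b.R.center (Cube.scale b.R.side + 2) :=
        cub_mono (by omega) (set_subset_cub b.R (b.subsetQR i (Cube.center_mem hQ.1.le)))
      exact cub_subset_cub_succ (mem_cub_comm.1 h1) hx
    obtain ⟨k, hk, hxk, hky⟩ := exists_scale_le_norm_sub (l := Cube.scale b.R.side + 2) hQ.1 hxQ hxl
      ((Cube.scale_mono hQ.1 (Cube.side_le_of_subset hd hQ.1.le (b.subsetQR i))).trans (by omega))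
    rw [add_assoc] at hk
    calc ∫⁻ y in Q.set, ENNReal.ofReal (φ y) ∂μ
        ≤ ∫⁻ y in Q.set, ENNReal.ofReal (((2 : ℝ) ^ k / 4) ^ n)⁻¹ ∂μ :=
          setLIntegral_mono measurable_const fun y hy =>
            ENNReal.ofReal_le_ofReal (hφ.le_of_le_norm (by positivity) (hky y hy))
      _ = (cub Q.center (k + 1)).indicator
          (fun _ => ENNReal.ofReal (((2 : ℝ) ^ k / 4) ^ n)⁻¹ * μ Q.set) x := by
          rw [setLIntegral_const, indicator_of_mem hxk]
      _ ≤ ∑ k ∈ Finset.Ico (Cube.scale Q.side) (Cube.scale b.R.side + 3),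
          (cub Q.center (k + 1)).indicator
            (fun _ => ENNReal.ofReal (((2 : ℝ) ^ k / 4) ^ n)⁻¹ * μ Q.set) x :=
          Finset.single_le_sum (f := fun k => (cub Q.center (k + 1)).indicator
            (fun _ => ENNReal.ofReal (((2 : ℝ) ^ k / 4) ^ n)⁻¹ * μ Q.set) x)
            (fun _ _ => zero_le) hk
      _ ≤ _ := le_add_self

end PreBlock

/-! ### A majorant for the local grand maximal function of a block -/

namespace PreBlock

section

variable {d n : ℕ} {μ : Measure (Euc d)} {C₀ K : ℝ} {f : Euc d → ℝ} {c : Euc d → ℝ → ℝ}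

theorem integral_fn_mul_eq_zero (b : PreBlock μ n) {x : Euc d} {φ : Euc d → ℝ}
    (hφ : TestFunLoc μ n x φ) (hR : 1 < b.R.side)
    (hx : x ∉ cub b.R.center (Cube.scale b.R.side + 1)) : ∫ y, b.fn y * φ y ∂μ = 0 := by
  refine integral_eq_zero_of_ae (ae_of_all _ fun y => ?_)
  by_cases hy : y ∈ b.R.set
  · have hφy : φ y = 0 := by
      by_contra hne
      have h0 : 0 ≤ Cube.scale b.R.side := by
        rw [show (0 : ℤ) = Cube.scale ((2 : ℝ) ^ (0 : ℤ)) from (Cube.scale_zpow 0).symm]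
        exact Cube.scale_mono (by positivity) (by simpa using hR.le)
      have h1 : y ∈ cub x 0 := by
        have := hφ.2 hne
        simpa [cub] using this
      exact hx (cub_subset_cub_succ (set_subset_cub b.R hy) (cub_mono h0 (mem_cub_comm.1 h1)))
    simp [hφy]
  · simp [b.fn_eq_zero hy]

theorem norm_sub_center_le (b : PreBlock μ n) {x y : Euc d} {φ : Euc d → ℝ}
    (hφ : TestFun μ n x φ) (j : ℕ) (hx : x ∉ cub b.R.center (Cube.scale b.R.side + 2 + j))
    (hy : y ∈ b.R.set) :
    ‖φ y - φ b.R.center‖ ≤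
      4 ^ (n + 1) * d * (1 / 2) ^ j * (((2 : ℝ) ^ (Cube.scale b.R.side + 2 + j)) ^ n)⁻¹ := by
  set e := Cube.scale b.R.side
  have hside := Cube.le_zpow_scale b.R.side
  have hP : (2 : ℝ) ^ (e + 2 + j) = 2 ^ e * (4 * 2 ^ j) := by
    rw [zpow_add₀ (by norm_num), zpow_add₀ (by norm_num), zpow_natCast]
    norm_num
    ring
  have he : (0 : ℝ) < 2 ^ e := by positivity
  have hj : (1 : ℝ) ≤ 2 ^ j := one_le_pow₀ (by norm_num)
  have hfar : ∀ z ∈ b.R.set, (2 : ℝ) ^ (e + 2 + j) / 4 ≤ ‖z - x‖ := fun z hz => by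
    refine le_trans ?_ (Cube.le_norm_sub (z := b.R.center) (r := b.R.side) hx hz)
    rw [hP]
    nlinarith
  have hder : ∀ z ∈ b.R.set, ‖fderiv ℝ φ z‖ ≤ (((2 : ℝ) ^ (e + 2 + j) / 4) ^ (n + 1))⁻¹ :=
    fun z hz => hφ.fderiv_le_of_le_norm (by positivity) (hfar z hz)
  have hmv := Convex.norm_image_sub_le_of_norm_fderiv_le
    (fun z _ => (hφ.2.1.differentiable one_ne_zero).differentiableAt) hder
    (Cube.convex_set b.R) (Cube.center_mem b.isCubeR.1.le) hy
  refine hmv.trans ?_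
  have hn : ‖y - b.R.center‖ ≤ d * (2 ^ e / 2) := by
    refine (Cube.norm_sub_le (x := b.R.center) (r := b.R.side) hy).trans ?_
    gcongr
  calc _ ≤ (((2 : ℝ) ^ (e + 2 + j) / 4) ^ (n + 1))⁻¹ * (d * (2 ^ e / 2)) := by gcongr
    _ = 4 ^ (n + 1) * d * (1 / 2) ^ j * (((2 : ℝ) ^ (e + 2 + j)) ^ n)⁻¹ / 8 := by
        rw [hP, one_div, inv_pow]
        simp only [div_pow, mul_pow, pow_succ]
        field_simp
        ring
    _ ≤ _ := div_le_self (by positivity) (by norm_num)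

theorem abs_integral_fn_mul_le (h : HasGrowth μ n C₀) (b : PreBlock μ n)
    (hb : b.R.side ≤ 1 → ∫ y, b.fn y ∂μ = 0) {x : Euc d} {φ : Euc d → ℝ}
    (hφ : TestFunLoc μ n x φ) (j : ℕ)
    (hx : x ∉ cub b.R.center (Cube.scale b.R.side + 2 + j)) :
    |∫ y, b.fn y * φ y ∂μ| ≤
      4 ^ (n + 1) * d * (1 / 2) ^ j * (((2 : ℝ) ^ (Cube.scale b.R.side + 2 + j)) ^ n)⁻¹ *
        b.size := by
  have hs := b.size_nonneg
  set w : ℝ := 4 ^ (n + 1) * d * (1 / 2) ^ j * (((2 : ℝ) ^ (Cube.scale b.R.side + 2 + j)) ^ n)⁻¹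
  have hw : 0 ≤ w := by positivity
  rcases le_or_gt b.R.side 1 with hR | hR
  · have hint : ∫ y, b.fn y * φ y ∂μ = ∫ y, b.fn y * (φ y - φ b.R.center) ∂μ := by
      simp only [mul_sub]
      rw [integral_sub (b.integrable_fn_mul h hφ) ((b.integrable_fn h).mul_const _),
        integral_mul_const, hb hR, zero_mul, sub_zero]
    have hn : ∫ y, ‖b.fn y‖ ∂μ ≤ b.size := by
      rw [integral_norm_eq_lintegral_enorm b.measurable_fn.aestronglyMeasurable]
      simp only [Real.enorm_eq_ofReal_abs]
      exact ENNReal.toReal_le_of_le_ofReal hs (b.lintegral_fn_le h)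
    rw [hint, ← Real.norm_eq_abs]
    calc ‖∫ y, b.fn y * (φ y - φ b.R.center) ∂μ‖
        ≤ ∫ y, w * ‖b.fn y‖ ∂μ := by
          refine norm_integral_le_of_norm_le ((b.integrable_fn h).norm.const_mul _)
            (ae_of_all _ fun y => ?_)
          by_cases hy : y ∈ b.R.set
          · rw [norm_mul, mul_comm]
            gcongr
            exact b.norm_sub_center_le hφ.1 j hx hy
          · simp [b.fn_eq_zero hy]
      _ ≤ w * b.size := by
          rw [integral_const_mul]
          gcongr
  · rw [b.integral_fn_mul_eq_zero hφ hR fun h' => hx (cub_mono (by omega) h'), abs_zero]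
    positivity

theorem _root_.RbmoCoeffs.abs_le_of_mem_cub (hc : RbmoCoeffs μ n f c K) (h : HasGrowth μ n C₀)
    {z x : Euc d} (hz : z ∈ admissible μ) (hx : x ∈ admissible μ) {r T : ℝ} (hr : 0 < r)
    (hT : ∀ k : ℤ, |c x ((2 : ℝ) ^ k)| ≤ T) (j : ℕ) (hxz : x ∈ cub z (Cube.scale r + j)) :
    |c z r| ≤ T + K * (1 + j * C₀) := by
  have h1 := hc.diff z hz x hx r ((2 : ℝ) ^ (Cube.scale r + j)) hr (by positivity)
  rw [Cube.scale_zpow] at h1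
  have h2 := h1 (by omega) (mem_cub_comm.1 hxz)
  have h3 := sig_le_card h hz (Cube.scale r) (Cube.scale r + j)
  simp only [add_sub_cancel_left, Int.toNat_natCast] at h3
  have h4 := abs_sub_abs_le_abs_sub (c z r) (c x ((2 : ℝ) ^ (Cube.scale r + j)))
  have h5 : K * (1 + sig μ n z (Cube.scale r) (Cube.scale r + j)) ≤ K * (1 + j * C₀) := by
    have := hc.nonneg
    gcongr
  linarith [hT (Cube.scale r + j)]

/-- The part of the majorant of a block that controls it away from its cube. -/
def farMajorant (b : PreBlock μ n) (v : ℕ → ℝ) (x : Euc d) : ℝ≥0∞ :=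
  ∑' j : ℕ, (cub b.R.center (Cube.scale b.R.side + 2 + j + 1)).indicator
    (fun _ => ENNReal.ofReal
      (v j * (((2 : ℝ) ^ (Cube.scale b.R.side + 2 + j)) ^ n)⁻¹ * b.size)) x

theorem measurable_farMajorant (b : PreBlock μ n) (v : ℕ → ℝ) : Measurable (b.farMajorant v) :=
  Measurable.tsum fun _ => measurable_const.indicator (measurableSet_cub _ _)

theorem lintegral_farMajorant_le (h : HasGrowth μ n C₀) (b : PreBlock μ n) {v : ℕ → ℝ}
    (hv : ∀ j, 0 ≤ v j) :
    ∫⁻ x, b.farMajorant v x ∂μ ≤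
      (∑' j, ENNReal.ofReal (v j * (2 ^ n * C₀))) * ENNReal.ofReal b.size := by
  have hC := h.pos
  have hs := b.size_nonneg
  unfold farMajorant
  rw [lintegral_tsum fun j =>
    (measurable_const.indicator (measurableSet_cub _ _)).aemeasurable, ← ENNReal.tsum_mul_right]
  refine ENNReal.tsum_le_tsum fun j => ?_
  have hvj := hv j
  rw [lintegral_indicator_const (measurableSet_cub _ _),
    ← ofReal_measureReal (h.measure_cub_ne_top _ _), ← ENNReal.ofReal_mul (by positivity),
    ← ENNReal.ofReal_mul (by positivity)]
  refine ENNReal.ofReal_le_ofReal ?_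
  have h1 := h.real_cub_le b.isCubeR.2 (Cube.scale b.R.side + 2 + j + 1)
  rw [zpow_two_succ, mul_pow] at h1
  set P := ((2 : ℝ) ^ (Cube.scale b.R.side + 2 + j)) ^ n
  have hP : 0 < P := by positivity
  calc _ ≤ v j * P⁻¹ * b.size * (C₀ * (2 ^ n * P)) := by gcongr
    _ = _ := by field_simp

theorem _root_.exists_mem_cub_succ (z x : Euc d) (k : ℤ) (hx : x ∉ cub z k) :
    ∃ j : ℕ, x ∉ cub z (k + j) ∧ x ∈ cub z (k + j + 1) := by
  classical
  have hex : ∃ j : ℕ, x ∈ cub z (k + j) := by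
    obtain ⟨j, hj⟩ := pow_unbounded_of_one_lt (2 * ‖x - z‖ / 2 ^ k) (one_lt_two (α := ℝ))
    refine ⟨j, fun i => ?_⟩
    have h1 : |x i - z i| ≤ ‖x - z‖ := PiLp.norm_apply_le (x - z) i
    rw [div_lt_iff₀ (by positivity)] at hj
    rw [zpow_add₀ (by norm_num), zpow_natCast]
    linarith
  have hpos : Nat.find hex ≠ 0 := fun h0 => hx (by simpa [h0] using Nat.find_spec hex)
  obtain ⟨j, hj⟩ := Nat.exists_eq_succ_of_ne_zero hpos
  refine ⟨j, Nat.find_min hex (by omega), ?_⟩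
  have := Nat.find_spec hex
  rw [hj] at this
  push_cast at this
  rwa [← add_assoc] at this

theorem exists_majorant (hd : 0 < d) (h : HasGrowth μ n C₀) (hc : RbmoCoeffs μ n f c K) :
    ∃ (C : ℝ) (A : ℝ≥0∞), 0 ≤ C ∧ A ≠ ⊤ ∧ ∀ b : PreBlock μ n,
      (b.R.side ≤ 1 → ∫ y, b.fn y ∂μ = 0) → ∃ G : Euc d → ℝ≥0∞, Measurable G ∧
        ∫⁻ x, G x ∂μ ≤ A * ENNReal.ofReal b.size ∧
        ∀ x ∈ admissible μ, ∀ T : ℝ, 0 ≤ T → (∀ k : ℤ, |c x ((2 : ℝ) ^ k)| ≤ T) →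
          ∀ φ, TestFunLoc μ n x φ →
            ENNReal.ofReal (|c b.R.center b.R.side| * |∫ y, b.fn y * φ y ∂μ|) ≤
              ENNReal.ofReal (T + C) * G x := by
  have hC := h.pos
  have hK := hc.nonneg
  set C : ℝ := 1 + K * (1 + 2 * C₀)
  have hC1 : 1 ≤ C := le_add_of_nonneg_right (by positivity)
  set v : ℕ → ℝ := fun j => 4 ^ (n + 1) * d * (1 / 2) ^ j * (1 + K * (1 + (j + 3) * C₀))
  have hv : ∀ j, 0 ≤ v j := fun j => by positivity
  have hsum : Summable fun j => v j * (2 ^ n * C₀) := by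
    have h1 : Summable fun j : ℕ => (1 / 2 : ℝ) ^ j := summable_geometric_two
    have h2 : Summable fun j : ℕ => (j : ℝ) ^ 1 * (1 / 2 : ℝ) ^ j :=
      summable_pow_mul_geometric_of_norm_lt_one 1 (by norm_num)
    refine (((h1.mul_left (4 ^ (n + 1) * d * (1 + K * (1 + 3 * C₀)))).add
      (h2.mul_left (4 ^ (n + 1) * d * (K * C₀)))).mul_right (2 ^ n * C₀)).congr fun j => ?_
    ring
  refine ⟨C, ENNReal.ofReal (1 + 8 ^ n * (2 ^ n + 4 * C₀)) +
    ∑' j, ENNReal.ofReal (v j * (2 ^ n * C₀)), by linarith,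
    ENNReal.add_ne_top.2 ⟨ENNReal.ofReal_ne_top, hsum.tsum_ofReal_ne_top⟩, fun b hb =>
    ⟨fun x => b.nearMajorant x + b.farMajorant v x,
      b.measurable_nearMajorant.add (b.measurable_farMajorant v), ?_, ?_⟩⟩
  · rw [lintegral_add_left b.measurable_nearMajorant, add_mul]
    exact add_le_add (b.lintegral_nearMajorant_le h) (b.lintegral_farMajorant_le h hv)
  · intro x hx T hT0 hT φ hφ
    have hs := b.size_nonneg
    by_cases hxR : x ∈ cub b.R.center (Cube.scale b.R.side + 2)
    · have h1 := hc.abs_le_of_mem_cub h b.isCubeR.2 hx b.isCubeR.1 hT 2 (by exact_mod_cast hxR)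
      rw [ENNReal.ofReal_mul (abs_nonneg _)]
      refine mul_le_mul' (ENNReal.ofReal_le_ofReal ?_) (le_trans ?_ le_self_add)
      · push_cast at h1
        linarith
      · rw [← Real.enorm_eq_ofReal_abs]
        refine ((enorm_integral_le_lintegral_enorm _).trans (le_of_eq ?_)).trans
          (b.lintegral_fn_mul_le_nearMajorant hd hφ.1 hxR)
        refine lintegral_congr fun y => ?_
        rw [Real.enorm_eq_ofReal_abs, abs_mul, ENNReal.ofReal_mul (abs_nonneg _),
          abs_of_nonneg (hφ.1.2.2.2.1 y)]
    · obtain ⟨j, hj, hj'⟩ := exists_mem_cub_succ _ _ _ hxR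
      have h1 := hc.abs_le_of_mem_cub h b.isCubeR.2 hx b.isCubeR.1 hT (j + 3)
        (by convert hj' using 2; push_cast; ring)
      have h2 := b.abs_integral_fn_mul_le h hb hφ j hj
      push_cast at h1
      have h3 : ENNReal.ofReal (v j * (((2 : ℝ) ^ (Cube.scale b.R.side + 2 + j)) ^ n)⁻¹ * b.size) ≤
          b.farMajorant v x := by
        refine le_trans (le_of_eq ?_) (ENNReal.le_tsum j)
        rw [indicator_of_mem hj']
      refine le_trans ?_ (mul_le_mul_right (h3.trans le_add_self) _)
      have hvj := hv j
      rw [← ENNReal.ofReal_mul (by positivity)]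
      refine ENNReal.ofReal_le_ofReal ?_
      set w : ℝ := 4 ^ (n + 1) * d * (1 / 2) ^ j *
        (((2 : ℝ) ^ (Cube.scale b.R.side + 2 + j)) ^ n)⁻¹ * b.size
      have hw : 0 ≤ w := by positivity
      set D := K * (1 + (j + 3) * C₀)
      have hD : 0 ≤ D := by positivity
      calc _ ≤ (T + D) * w := by gcongr
        _ ≤ (T + C) * ((1 + D) * w) := by
            rw [← mul_assoc (T + C)]
            refine mul_le_mul_of_nonneg_right ?_ hw
            nlinarith
        _ = _ := by
            simp only [w, v, D]
            ring

theorem grandMLoc_sum_le (h : HasGrowth μ n C₀) (B : ℕ → PreBlock μ n) (s : Finset ℕ)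
    {γ : ℕ → ℝ} {G : ℕ → ℝ≥0∞} {x : Euc d}
    (hG : ∀ j ∈ s, ∀ φ, TestFunLoc μ n x φ →
      ENNReal.ofReal (|γ j| * |∫ y, (B j).fn y * φ y ∂μ|) ≤ G j) :
    ENNReal.ofReal |grandMLoc μ n (fun y => ∑ j ∈ s, γ j * (B j).fn y) x| ≤ ∑ j ∈ s, G j := by
  rcases eq_or_ne (∑ j ∈ s, G j) ⊤ with htop | htop
  · simp [htop]
  have hnn : 0 ≤ grandMLoc μ n (fun y => ∑ j ∈ s, γ j * (B j).fn y) x :=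
    Real.sSup_nonneg fun r hr => by
      obtain ⟨φ, -, rfl⟩ := hr
      exact abs_nonneg _
  rw [abs_of_nonneg hnn]
  refine ENNReal.ofReal_le_of_le_toReal (Real.sSup_le ?_ ENNReal.toReal_nonneg)
  rintro r ⟨φ, hφ, rfl⟩
  have hint : ∫ y, (∑ j ∈ s, γ j * (B j).fn y) * φ y ∂μ =
      ∑ j ∈ s, γ j * ∫ y, (B j).fn y * φ y ∂μ := by
    simp only [Finset.sum_mul, mul_assoc]
    rw [integral_finsetSum _ fun j _ => ((B j).integrable_fn_mul h hφ).const_mul _]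
    simp only [integral_const_mul]
  rw [hint, ENNReal.toReal_sum fun j hj => ne_top_of_le_ne_top htop
    (Finset.single_le_sum (fun _ _ => zero_le) hj)]
  refine (Finset.abs_sum_le_sum_abs _ _).trans (Finset.sum_le_sum fun j hj => ?_)
  rw [abs_mul]
  exact (ENNReal.ofReal_le_iff_le_toReal (ne_top_of_le_ne_top htop
    (Finset.single_le_sum (fun _ _ => zero_le) hj))).1 (hG j hj φ hφ)

theorem exists_tsum_orliczNormOn_le (hd : 0 < d) (h : HasGrowth μ n C₀)
    (hc : RbmoCoeffs μ n f c K) (hf : AEMeasurable f μ) (B : ℕ → PreBlock μ n)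
    (hB : ∀ j, (B j).R.side ≤ 1 → ∫ y, (B j).fn y ∂μ = 0) :
    ∃ D : ℝ≥0∞, D ≠ ⊤ ∧ ∀ (s : Finset ℕ) (γ : ℕ → ℝ),
      (∀ j, |γ j| = |c (B j).R.center (B j).R.side|) →
      ∑' m, orliczNormOn wp μ (latCube d m) (grandMLoc μ n fun x => ∑ j ∈ s, γ j * (B j).fn x) ≤
        D * ∑ j ∈ s, ENNReal.ofReal (B j).size := by
  obtain ⟨C, A₁, hC, hA₁, hmaj⟩ := exists_majorant hd h hc
  choose G hGm hGi hG using fun j => hmaj (B j) (hB j)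
  obtain ⟨κ, A, W, hκ, hA, hW, hWa, hWi⟩ := exists_exp_majorant hc.dyadicCoeffs h hf
  obtain ⟨D, hD, hor⟩ := exists_orliczNormOn_wp_le μ hκ hC hA
  refine ⟨D * A₁, ENNReal.mul_ne_top hD hA₁, fun s γ hγ => ?_⟩
  have hGs : Measurable fun x => ∑ j ∈ s, G j x := Finset.measurable_sum _ fun j _ => hGm j
  have hadm : ∀ᵐ x ∂μ, x ∈ admissible μ := measure_compl_admissible μ
  calc _ ≤ ∑' m, D * ∫⁻ x in latCube d m, ∑ j ∈ s, G j x ∂μ := by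
        refine ENNReal.tsum_le_tsum fun m => hor _ W _ _ hW hGs (hWi m) ?_
        filter_upwards [ae_restrict_of_ae hadm,
          ae_lt_top hW (ne_top_of_le_ne_top hA (hWi m))] with x hx hWx
        have hexp : ∀ k : ℤ, Real.exp (κ * |c x ((2 : ℝ) ^ k)|) ≤ (W x).toReal := fun k =>
          (ENNReal.ofReal_le_iff_le_toReal hWx.ne).1 (hWa x hx k)
        have hT : ∀ k : ℤ, |c x ((2 : ℝ) ^ k)| ≤ Real.log (W x).toReal / κ := fun k => by
          rw [le_div_iff₀ hκ, mul_comm]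
          exact (Real.le_log_iff_exp_le ((Real.exp_pos _).trans_le (hexp k))).2 (hexp k)
        have hT0 : 0 ≤ Real.log (W x).toReal / κ := (abs_nonneg _).trans (hT 0)
        refine ⟨Real.log (W x).toReal / κ, hT0, ?_, ?_⟩
        · rw [mul_div_cancel₀ _ hκ.ne', Real.exp_log ((Real.exp_pos _).trans_le (hexp 0)),
            ENNReal.ofReal_toReal hWx.ne]
        · rw [Finset.mul_sum]
          refine grandMLoc_sum_le h B s fun j _ φ hφ => ?_
          rw [hγ]
          exact hG j x hx _ hT0 hT φ hφ
    _ = D * ∫⁻ x in ⋃ m, latCube d m, ∑ j ∈ s, G j x ∂μ := by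
        rw [ENNReal.tsum_mul_left,
          lintegral_iUnion measurableSet_latCube pairwise_disjoint_latCube]
    _ ≤ D * ∑ j ∈ s, A₁ * ENNReal.ofReal (B j).size := by
        refine mul_le_mul_right ((setLIntegral_le_lintegral _ _).trans ?_) _
        rw [lintegral_finsetSum _ fun j _ => hGm j]
        exact Finset.sum_le_sum fun j _ => hGi j
    _ = _ := by rw [← Finset.mul_sum, mul_assoc]

theorem tendsto_tsum_orliczNormOn (hd : 0 < d) (h : HasGrowth μ n C₀)
    (hc : RbmoCoeffs μ n f c K) (hf : AEMeasurable f μ) (B : ℕ → PreBlock μ n)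
    (hB : ∀ j, (B j).R.side ≤ 1 → ∫ y, (B j).fn y ∂μ = 0) (hsum : Summable fun j => (B j).size) :
    Tendsto (fun p : ℕ × ℕ => ∑' m, orliczNormOn wp μ (latCube d m) (grandMLoc μ n fun x =>
      (∑ j ∈ Finset.range p.1, c (B j).R.center (B j).R.side * (B j).fn x) -
        ∑ j ∈ Finset.range p.2, c (B j).R.center (B j).R.side * (B j).fn x)) atTop (𝓝 0) := by
  obtain ⟨D, hD, hle⟩ := exists_tsum_orliczNormOn_le hd h hc hf B hB
  have hmin : Tendsto (fun p : ℕ × ℕ => min p.1 p.2) atTop atTop :=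
    tendsto_atTop.2 fun k => (eventually_ge_atTop (k, k)).mono fun p hp => le_min hp.1 hp.2
  have htail := (ENNReal.tendsto_sum_nat_add (fun j => ENNReal.ofReal (B j).size)
    hsum.tsum_ofReal_ne_top).comp hmin
  have hlim := ENNReal.Tendsto.const_mul htail (Or.inr hD)
  rw [mul_zero] at hlim
  have hIco : ∀ k l : ℕ, ∑ j ∈ Finset.Ico k l, ENNReal.ofReal (B j).size ≤
      ∑' j, ENNReal.ofReal (B (j + k)).size := fun k l => by
    rw [Finset.sum_Ico_eq_sum_range]
    simp only [add_comm k]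
    exact ENNReal.sum_le_tsum _
  refine tendsto_of_tendsto_of_tendsto_of_le_of_le tendsto_const_nhds hlim (fun _ => zero_le)
    fun p => ?_
  simp only [Function.comp_apply]
  rcases le_total p.1 p.2 with hp | hp
  · rw [min_eq_left hp]
    refine le_trans ?_ ((hle (Finset.Ico p.1 p.2) (fun j => -c (B j).R.center (B j).R.side)
      fun j => abs_neg _).trans (mul_le_mul_right (hIco _ _) _))
    simp only [neg_mul, Finset.sum_neg_distrib, Finset.sum_Ico_eq_sub _ hp, neg_sub_neg, le_refl]
  · rw [min_eq_right hp]
    refine le_trans ?_ ((hle (Finset.Ico p.2 p.1) (fun j => c (B j).R.center (B j).R.side)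
      fun j => rfl).trans (mul_le_mul_right (hIco _ _) _))
    simp only [Finset.sum_Ico_eq_sub _ hp, le_refl]

end

end PreBlock

/-- Proposition: `rbmo × h¹`, with `ρ = 2`: for `f ∈ rbmo(μ)` and
`h = ∑_j b_j` with `∑_j |b_j| < ∞`, where `b_j` is an `∞`-atomic block when
`ℓ(R_j) ≤ 1` (cancellation) and an `∞`-block when `ℓ(R_j) > 1`:
(i) `∑_j ‖(f − f_{R̃_j}) b_j‖_{L¹(μ)} < ∞`, and
(ii) the partial sums `k_N = ∑_{j<N} f_{R̃_j} b_j` are Cauchy in `h^℘_*(μ)` for the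
local grand maximal function `M^{(1)}`. -/
theorem product_rbmoLoc_h1loc
    {d n : ℕ} (μ : Measure (Euc d)) (C₀ η β : ℝ)
    (hn : 0 < n) (hnd : n ≤ d) (hC₀ : 0 < C₀)
    (hgrowth : ∀ x : Euc d, ∀ r : ℝ, 0 < r →
      μ (Metric.ball x r) ≤ ENNReal.ofReal (C₀ * r ^ n))
    (hgrowthQ : ∀ Q : Cube d, IsCube μ Q → μ Q.set ≤ ENNReal.ofReal (C₀ * Q.side ^ n))
    (hη : 1 < η) (hηρ : η ≤ 2) (hβ : (2 : ℝ) ^ n < β)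
    (f : Euc d → ℝ) (hf : MemRbmoLoc μ n η 2 β f)
    (B : ℕ → PreBlock μ n)
    (hcancel : ∀ j, (B j).R.side ≤ 1 → ∫ x, (B j).fn x ∂μ = 0)
    (hB : Summable fun j => (B j).size) :
    (∑' j : ℕ,
        ∫⁻ x, ENNReal.ofReal
          (|f x - cubeAvg μ (tilde μ 2 β (B j).R) f| * |(B j).fn x|) ∂μ) < ⊤ ∧
    Tendsto
      (fun p : ℕ × ℕ =>
        ∑' m : Fin d → ℤ,
          orliczNormOn wp μ (latCube d m)
            (grandMLoc μ n (fun x =>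
              (∑ j ∈ Finset.range p.1, cubeAvg μ (tilde μ 2 β (B j).R) f * (B j).fn x) -
              (∑ j ∈ Finset.range p.2, cubeAvg μ (tilde μ 2 β (B j).R) f * (B j).fn x))))
      atTop (𝓝 0) := by
  have h : HasGrowth μ n C₀ := ⟨hC₀, hgrowth, hgrowthQ⟩
  have hd : 0 < d := hn.trans_le hnd
  obtain ⟨K, hc⟩ := exists_rbmoCoeffs h hβ hηρ hf
  have := h.isLocallyFiniteMeasure
  have hfm : AEMeasurable f μ := hf.1.aestronglyMeasurable.aemeasurable
  exact ⟨PreBlock.tsum_lintegral_osc_lt_top hc h hd hfm B hB,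
    PreBlock.tendsto_tsum_orliczNormOn hd h hc hfm B hcancel hB⟩
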